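/- For partitions α, β, ν of n, lr*(α,β;ν') = Σ_{γ ⊴ ν} K_{γ'ν'} · k(α,β,γ), where the sum is over partitions γ of n dominated by ν and γ' denotes conjugation. -/

import Mathlib

open Finset Equiv
open scoped Classical

noncomputable section

/-- Value at `g` of the permutation character of `S_n` induced from the trivial character of
the Young subgroup of the composition `c`: the number of colorings of `Fin n` with fiber
sizes given by `c` that are fixed by `g`. -/
def permChar (n : ℕ) (c : ℕ → ℕ) (g : Perm (Fin n)) : ℚ :=
  Nat.card {f : Fin n → ℕ // (∀ k, Nat.card {x : Fin n // f x = k} = c k) ∧ ∀ x, f (g x) = f x}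

/-- Inner product of class functions (real-valued characters) of `S_n`. -/
def innerChar (n : ℕ) (χ ψ : Perm (Fin n) → ℚ) : ℚ :=
  (∑ g : Perm (Fin n), χ g * ψ g) / (n.factorial : ℚ)

/-- The trivial character `χ^{(n)}` of `S_n`. -/
def trivChar (n : ℕ) : Perm (Fin n) → ℚ := fun _ => 1

/-- The sign character `χ^{(1^n)}` of `S_n`. -/
def signChar (n : ℕ) : Perm (Fin n) → ℚ := fun g => ((Perm.sign g : ℤ) : ℚ)

/-- Permutation character for an integer vector: zero if some entry is negative. -/
def permCharZ (n : ℕ) (c : ℕ → ℤ) (g : Perm (Fin n)) : ℚ :=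
  if ∀ k, 0 ≤ c k then permChar n (fun k => (c k).toNat) g else 0

/-- The irreducible character `χ^a` of `S_n` indexed by the partition `a`, given by the
Jacobi–Trudi determinantal formula `χ^a = ∑_σ sgn(σ) φ^{(a_i - i + σ(i))_i}`. -/
def irrChar (n : ℕ) (a : ℕ → ℕ) (g : Perm (Fin n)) : ℚ :=
  ∑ σ : Perm (Fin n), ((Perm.sign σ : ℤ) : ℚ) *
    permCharZ n (fun i => if h : i < n then (a i : ℤ) - i + ((σ ⟨i, h⟩ : Fin n) : ℕ) else 0) g

/-- Kronecker coefficient `k(a,b,c) = ⟨χ^a ⊗ χ^b, χ^c⟩`. -/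
def kron (n : ℕ) (a b c : ℕ → ℕ) : ℚ :=
  innerChar n (fun g => irrChar n a g * irrChar n b g) (irrChar n c)

/-- Extend a vector indexed by `Fin p` to `ℕ` by zeros. -/
def extc {p : ℕ} (l : Fin p → ℕ) : ℕ → ℕ := fun i => if h : i < p then l ⟨i, h⟩ else 0

/-- Dominance order: `a ⊵ b`. -/
def Dominates (a b : ℕ → ℕ) : Prop :=
  ∀ k, ∑ i ∈ Finset.range k, b i ≤ ∑ i ∈ Finset.range k, a i

/-- Conjugate (transpose) of a partition with at most `n` parts. -/
def conjFun (n : ℕ) (a : ℕ → ℕ) : ℕ → ℕ :=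
  fun j => ((Finset.range n).filter (fun i => j < a i)).card

/-- `a` is a partition of `n` (weakly decreasing, supported on the first `n` parts). -/
def IsPartitionFun (n : ℕ) (a : ℕ → ℕ) : Prop :=
  (∀ i j, i ≤ j → a j ≤ a i) ∧ (∀ i, n ≤ i → a i = 0) ∧ ∑ i ∈ Finset.range n, a i = n

/-- The weakly decreasing sequence of parts of `P : Nat.Partition n`. -/
def pf {n : ℕ} (P : n.Partition) : ℕ → ℕ :=
  fun i => ((P.parts.sort (· ≤ ·)).reverse).getD i 0

/-- The parts of `P : Nat.Partition n` as a vector of length `n`. -/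
def pfin {n : ℕ} (P : n.Partition) : Fin n → ℕ := fun k => pf P k

/-- Number of cells of the skew shape `a/b` where the filling `T` has entry `k`. -/
def skewContent (a b : ℕ → ℕ) (T : ℕ → ℕ → ℕ) (k : ℕ) : ℕ :=
  Nat.card {p : ℕ × ℕ // b p.1 ≤ p.2 ∧ p.2 < a p.1 ∧ T p.1 p.2 = k}

/-- Number of cells of the skew shape `a/b`. -/
def skewSize (a b : ℕ → ℕ) : ℕ :=
  Nat.card {p : ℕ × ℕ // b p.1 ≤ p.2 ∧ p.2 < a p.1}

/-- `T` is a semistandard filling of the shape `a` (zero outside, rows weakly increasing,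
columns strictly increasing). -/
def IsSSYT (a : ℕ → ℕ) (T : ℕ → ℕ → ℕ) : Prop :=
  (∀ i j, a i ≤ j → T i j = 0) ∧
  (∀ i j₁ j₂, j₁ ≤ j₂ → j₂ < a i → T i j₁ ≤ T i j₂) ∧
  (∀ i₁ i₂ j, i₁ < i₂ → j < a i₂ → T i₁ j < T i₂ j)

/-- The Kostka number: the number of semistandard Young tableaux of shape `a`
and content `c`. -/
def kostka (a c : ℕ → ℕ) : ℕ :=
  Nat.card {T : ℕ → ℕ → ℕ // IsSSYT a T ∧ ∀ k, skewContent a (fun _ => 0) T k = c k}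

/-- Number of entries equal to `k` in the prefix of the (right-to-left, top-to-bottom)
reading word of `T` ending at position `(i,j)`. -/
def lrCount (a b : ℕ → ℕ) (T : ℕ → ℕ → ℕ) (i j k : ℕ) : ℕ :=
  Nat.card {p : ℕ × ℕ //
    (p.1 < i ∨ (p.1 = i ∧ j ≤ p.2)) ∧ b p.1 ≤ p.2 ∧ p.2 < a p.1 ∧ T p.1 p.2 = k}

/-- `T` is a Littlewood–Richardson skew tableau of shape `a/b`: semistandard and its
reverse reading word is a lattice word. -/
def IsLR (a b : ℕ → ℕ) (T : ℕ → ℕ → ℕ) : Prop :=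
  (∀ i j, ¬(b i ≤ j ∧ j < a i) → T i j = 0) ∧
  (∀ i j₁ j₂, b i ≤ j₁ → j₁ ≤ j₂ → j₂ < a i → T i j₁ ≤ T i j₂) ∧
  (∀ i₁ i₂ j, i₁ < i₂ → b i₁ ≤ j → j < a i₁ → b i₂ ≤ j → j < a i₂ → T i₁ j < T i₂ j) ∧
  (∀ i j k, lrCount a b T i j (k + 1) ≤ lrCount a b T i j k)

/-- A Littlewood–Richardson multitableau of shape `α` with `r` parts: a chain of
partitions `0 = α(0) ⊆ α(1) ⊆ ⋯ ⊆ α(r) = α` together with Littlewood–Richardson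
fillings of the successive skew shapes. -/
structure LRMultiF (r : ℕ) (α : ℕ → ℕ) where
  chain : Fin (r + 1) → ℕ → ℕ
  antitone : ∀ k i j, i ≤ j → chain k j ≤ chain k i
  zero : ∀ i, chain 0 i = 0
  last : ∀ i, chain (Fin.last r) i = α i
  mono : ∀ (k : Fin r) (i : ℕ), chain k.castSucc i ≤ chain k.succ i
  T : Fin r → ℕ → ℕ → ℕ
  lr : ∀ k : Fin r, IsLR (chain k.succ) (chain k.castSucc) (T k)

/-- Content of the `k`-th tableau of a Littlewood–Richardson multitableau. -/
def LRMultiF.cont {r : ℕ} {α : ℕ → ℕ} (M : LRMultiF r α) (k : Fin r) : ℕ → ℕ :=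
  skewContent (M.chain k.succ) (M.chain k.castSucc) (M.T k)

/-- Size of the `k`-th tableau of a Littlewood–Richardson multitableau. -/
def LRMultiF.size {r : ℕ} {α : ℕ → ℕ} (M : LRMultiF r α) (k : Fin r) : ℕ :=
  skewSize (M.chain k.succ) (M.chain k.castSucc)

/-- `LR(α,β;ν)`: pairs of Littlewood–Richardson multitableaux of shapes `α`, `β`,
type `ν`, with equal contents. -/
def LRPairs (r : ℕ) (α β : ℕ → ℕ) (ν : Fin r → ℕ) :=
  {TS : LRMultiF r α × LRMultiF r β //
    (∀ k, TS.1.size k = ν k) ∧ (∀ k, TS.2.size k = ν k) ∧ ∀ k, TS.1.cont k = TS.2.cont k}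

/-- `LR*(α,β;ν)`: pairs of Littlewood–Richardson multitableaux of shapes `α`, `β`,
type `ν`, with termwise conjugate contents. -/
def LRPairsStar (n r : ℕ) (α β : ℕ → ℕ) (ν : Fin r → ℕ) :=
  {TS : LRMultiF r α × LRMultiF r β //
    (∀ k, TS.1.size k = ν k) ∧ (∀ k, TS.2.size k = ν k) ∧
      ∀ k m, TS.2.cont k m = conjFun n (TS.1.cont k) m}

/-- `lr(α,β;ν)`. -/
def lrNum (r : ℕ) (α β : ℕ → ℕ) (ν : Fin r → ℕ) : ℕ := Nat.card (LRPairs r α β ν)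

/-- `lr*(α,β;ν)`. -/
def lrStarNum (n r : ℕ) (α β : ℕ → ℕ) (ν : Fin r → ℕ) : ℕ :=
  Nat.card (LRPairsStar n r α β ν)

/-- A semistandard Young tableau (of arbitrary partition shape). -/
structure SSYTP where
  shape : ℕ → ℕ
  T : ℕ → ℕ → ℕ
  antitone : ∀ i j, i ≤ j → shape j ≤ shape i
  finite : ∃ N, ∀ i, N ≤ i → shape i = 0
  ssyt : IsSSYT shape T

/-- Content of a semistandard Young tableau. -/
def SSYTP.cont (P : SSYTP) : ℕ → ℕ := skewContent P.shape (fun _ => 0) P.T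

/-- The multiset of entries of a matrix. -/
def entriesM {p q : ℕ} (A : Fin p → Fin q → ℕ) : Multiset ℕ :=
  (Finset.univ : Finset (Fin p × Fin q)).val.map (fun ij => A ij.1 ij.2)

/-- The π-sequence of `A` is the partition `ν` (the weakly decreasing rearrangement of
the entries of `A` is `ν`). -/
def HasPiSeq {p q : ℕ} (A : Fin p → Fin q → ℕ) {n : ℕ} (ν : n.Partition) : Prop :=
  (entriesM A).filter (· ≠ 0) = ν.parts

end

namespace KroneckerLR
noncomputable section

/-! ### Alternants -/

/-- The monomial with exponent vector `v`. -/
def mono {n : ℕ} (v : Fin n → ℕ) : MvPolynomial (Fin n) ℚ :=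
  MvPolynomial.monomial (Finsupp.equivFunOnFinite.symm v) 1

/-- The coefficient of the monomial with exponent vector `v`, as a linear functional. -/
def cf {n : ℕ} (v : Fin n → ℕ) : MvPolynomial (Fin n) ℚ →ₗ[ℚ] ℚ :=
  MvPolynomial.lcoeff ℚ (Finsupp.equivFunOnFinite.symm v)

lemma cf_mono {n : ℕ} (v w : Fin n → ℕ) : cf v (mono w) = if w = v then 1 else 0 := by
  simp [cf, mono, MvPolynomial.lcoeff, MvPolynomial.coeff_monomial]

lemma mono_mul {n : ℕ} (v w : Fin n → ℕ) : mono v * mono w = mono (v + w) := by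
  have : Finsupp.equivFunOnFinite.symm (v + w) =
      Finsupp.equivFunOnFinite.symm v + Finsupp.equivFunOnFinite.symm w := by ext i; simp
  simp only [mono, MvPolynomial.monomial_mul, mul_one, this]

lemma mono_zero {n : ℕ} : mono (0 : Fin n → ℕ) = 1 := by
  have : Finsupp.equivFunOnFinite.symm (0 : Fin n → ℕ) = 0 := by ext i; simp
  rw [mono, this]; rfl

lemma prod_mono {n : ℕ} {ι : Type*} (s : Finset ι) (v : ι → Fin n → ℕ) :
    ∏ i ∈ s, mono (v i) = mono (∑ i ∈ s, v i) := by
  induction s using Finset.induction_on with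
  | empty => simp [mono_zero]
  | insert a s ha ih => rw [prod_insert ha, sum_insert ha, ih, mono_mul]

lemma cf_ext {n : ℕ} {f g : MvPolynomial (Fin n) ℚ} (h : ∀ v, cf v f = cf v g) : f = g := by
  ext m
  have := h (Finsupp.equivFunOnFinite m)
  simpa [cf, MvPolynomial.lcoeff] using this

lemma cf_mul_mono {n : ℕ} (v w : Fin n → ℕ) (f : MvPolynomial (Fin n) ℚ) :
    cf v (mono w * f) = if ∀ i, w i ≤ v i then cf (fun i => v i - w i) f else 0 := by
  simp only [cf, mono, MvPolynomial.lcoeff, LinearMap.coe_mk, AddHom.coe_mk,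
    MvPolynomial.coeff_monomial_mul', one_mul]
  refine if_congr ?_ ?_ rfl
  · simp [Finsupp.le_def]
  · congr 1
    ext i; simp

/-- The alternant with exponent vector `v`. -/
def alt {n : ℕ} (v : Fin n → ℕ) : MvPolynomial (Fin n) ℚ :=
  ∑ σ : Perm (Fin n), ((Perm.sign σ : ℤ) : ℚ) • mono (v ∘ σ)

lemma alt_comp {n : ℕ} (v : Fin n → ℕ) (τ : Perm (Fin n)) :
    alt (v ∘ τ) = ((Perm.sign τ : ℤ) : ℚ) • alt v := by
  unfold alt
  rw [smul_sum]
  refine Fintype.sum_equiv (Equiv.mulLeft τ) _ _ fun σ => ?_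
  rw [smul_smul]
  congr 1
  rcases Int.units_eq_one_or (Perm.sign τ) with h | h <;> simp [h]

lemma alt_comp_swap {n : ℕ} (v : Fin n → ℕ) {i j : Fin n} (h : i ≠ j) :
    alt (v ∘ swap i j) = - alt v := by
  rw [alt_comp, Perm.sign_swap h]; simp

lemma alt_eq_zero {n : ℕ} (v : Fin n → ℕ) {i j : Fin n} (h : i ≠ j) (hv : v i = v j) :
    alt v = 0 := by
  have h1 := alt_comp_swap v h
  have h2 : v ∘ swap i j = v := by
    ext k
    simp only [Function.comp, swap_apply_def]
    split_ifs <;> simp_all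
  rw [h2] at h1
  exact self_eq_neg.mp h1

lemma alt_mul_sum {n : ℕ} {ι : Type*} (T : Finset ι) (w : ι → Fin n → ℕ)
    (hsymm : ∀ σ : Perm (Fin n), ∑ t ∈ T, mono (w t ∘ σ) = ∑ t ∈ T, mono (w t))
    (v : Fin n → ℕ) :
    alt v * ∑ t ∈ T, mono (w t) = ∑ t ∈ T, alt (v + w t) := by
  simp only [alt]
  rw [sum_mul, sum_comm]
  refine sum_congr rfl fun σ _ => ?_
  rw [← hsymm σ, mul_sum]
  refine sum_congr rfl fun t _ => ?_
  rw [smul_mul_assoc, mono_mul]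
  rfl

/-! ### Shapes -/

/-- `a` is a partition with at most `n` parts. -/
structure IsShape (n : ℕ) (a : ℕ → ℕ) : Prop where
  anti : Antitone a
  zero : ∀ i, n ≤ i → a i = 0

/-- The size of a shape with at most `n` parts. -/
def size (n : ℕ) (a : ℕ → ℕ) : ℕ := ∑ i ∈ range n, a i

lemma le_size {n : ℕ} {a : ℕ → ℕ} (h : IsShape n a) (i : ℕ) : a i ≤ size n a := by
  by_cases hi : i < n
  · exact single_le_sum (f := a) (fun _ _ => Nat.zero_le _) (mem_range.2 hi)
  · rw [h.zero i (not_lt.1 hi)]; exact Nat.zero_le _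

lemma finite_shapes (n d : ℕ) : {a : ℕ → ℕ | IsShape n a ∧ size n a = d}.Finite := by
  refine Set.Finite.of_finite_image (f := fun a => fun i : Fin n => a i) ?_ ?_
  · refine (Set.Finite.pi' (ι := Fin n) (t := fun _ => Set.Iic d)
      (fun _ => Set.finite_Iic d)).subset ?_
    rintro _ ⟨a, ⟨ha, hd⟩, rfl⟩ i
    exact hd ▸ le_size ha i
  · rintro a ⟨ha, -⟩ b ⟨hb, -⟩ hab
    funext i
    by_cases hi : i < n
    · exact congrFun hab ⟨i, hi⟩
    · rw [ha.zero i (not_lt.1 hi), hb.zero i (not_lt.1 hi)]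

/-- The partitions of `d` with at most `n` parts. -/
def shapes (n d : ℕ) : Finset (ℕ → ℕ) := (finite_shapes n d).toFinset

lemma mem_shapes {n d : ℕ} {a : ℕ → ℕ} : a ∈ shapes n d ↔ IsShape n a ∧ size n a = d := by
  simp [shapes]

lemma isShape_zero (n : ℕ) : IsShape n 0 := ⟨fun _ _ _ => le_rfl, fun _ _ => rfl⟩

lemma shapes_zero (n : ℕ) : shapes n 0 = {0} := by
  ext a
  rw [mem_shapes, mem_singleton]
  constructor
  · rintro ⟨ha, h⟩
    funext i
    exact Nat.le_zero.1 (h ▸ le_size ha i)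
  · rintro rfl
    exact ⟨isShape_zero n, by simp [size]⟩

/-- The exponent vector `a + δ`, where `δ = (n - 1, …, 1, 0)`. -/
def shift (n : ℕ) (a : ℕ → ℕ) : Fin n → ℕ := fun i => a i + (n - 1 - i)

lemma shift_strictAnti {n : ℕ} {a : ℕ → ℕ} (h : Antitone a) : StrictAnti (shift n a) := by
  intro i j hij
  have := h (show (i : ℕ) ≤ j from hij.le)
  have h2 : (i : ℕ) < j := hij
  simp only [shift]
  omega

lemma shift_injective {n : ℕ} {a b : ℕ → ℕ} (ha : IsShape n a) (hb : IsShape n b)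
    (h : shift n a = shift n b) : a = b := by
  funext i
  by_cases hi : i < n
  · have := congrFun h ⟨i, hi⟩
    simpa [shift] using this
  · rw [ha.zero i (not_lt.1 hi), hb.zero i (not_lt.1 hi)]

lemma perm_eq_one_of_strictAnti {n : ℕ} {v w : Fin n → ℕ} (hv : StrictAnti v)
    (hw : StrictAnti w) {σ : Perm (Fin n)} (h : w ∘ σ = v) : σ = 1 := by
  have hs : StrictMono σ := by
    intro i j hij
    have := hv hij
    rw [← h] at this
    exact hw.lt_iff_gt.1 this
  have := Subsingleton.elim (hs.orderIsoOfSurjective σ σ.surjective) (OrderIso.refl _)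
  ext i
  have h2 := congrArg (fun e : Fin n ≃o Fin n => (e i : ℕ)) this
  simpa using h2

lemma cf_alt {n : ℕ} {a b : ℕ → ℕ} (ha : IsShape n a) (hb : IsShape n b) :
    cf (shift n a) (alt (shift n b)) = if b = a then 1 else 0 := by
  simp only [alt, map_sum, map_smul, cf_mono, smul_eq_mul, mul_ite, mul_one, mul_zero]
  rw [sum_eq_single 1]
  · simp only [Perm.sign_one, Units.val_one, Int.cast_one, Perm.coe_one, Function.comp_id]
    refine if_congr ⟨shift_injective hb ha, fun h => by rw [h]⟩ rfl rfl
  · intro σ _ hσ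
    rw [if_neg]
    intro h
    exact hσ (perm_eq_one_of_strictAnti (shift_strictAnti ha.anti) (shift_strictAnti hb.anti) h)
  · simp

lemma alt_zero_ne_zero (n : ℕ) : alt (shift n 0) ≠ 0 := by
  intro h
  have := cf_alt (isShape_zero n) (isShape_zero n)
  simp [h] at this

/-- Extension of a vector indexed by `Fin n` by zeros, added to the shape `a`. -/
def addVec {n : ℕ} (a : ℕ → ℕ) (w : Fin n → ℕ) : ℕ → ℕ := fun i => a i + extc w i

lemma shift_add {n : ℕ} (a : ℕ → ℕ) (w : Fin n → ℕ) :
    shift n a + w = shift n (addVec a w) := by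
  funext i
  simp only [shift, addVec, extc, Pi.add_apply, Fin.is_lt, dif_pos, Fin.eta]
  omega

lemma size_addVec {n : ℕ} (a : ℕ → ℕ) (w : Fin n → ℕ) :
    size n (addVec a w) = size n a + ∑ i, w i := by
  simp only [size, addVec, sum_add_distrib, add_right_inj]
  rw [sum_range]
  exact sum_congr rfl fun i _ => by simp [extc]

/-- Groups a sum of alternants by shape. -/
lemma sum_alt_fiberwise {n d : ℕ} {ι : Type*} (T : Finset ι) (b : ι → ℕ → ℕ)
    (hb : ∀ t ∈ T, b t ∈ shapes n d) :
    ∑ t ∈ T, alt (shift n (b t)) =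
      ∑ l ∈ shapes n d, ((#{t ∈ T | b t = l} : ℕ) : ℚ) • alt (shift n l) := by
  rw [← sum_fiberwise_of_maps_to hb]
  refine sum_congr rfl fun l _ => ?_
  rw [sum_congr rfl (g := fun _ => alt (shift n l)) (fun t ht => by rw [(mem_filter.1 ht).2]),
    sum_const, Nat.cast_smul_eq_nsmul]

/-! ### Pieri rules -/

/-- `l / m` is a vertical strip. -/
def VertStrip (m l : ℕ → ℕ) : Prop := ∀ i, m i ≤ l i ∧ l i ≤ m i + 1

/-- `l / m` is a horizontal strip. -/
def HorizStrip (m l : ℕ → ℕ) : Prop := ∀ i, m i ≤ l i ∧ l (i + 1) ≤ m i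

lemma IsShape.addVec {n : ℕ} {a : ℕ → ℕ} {w : Fin n → ℕ} (ha : IsShape n a)
    (h : ∀ i, i + 1 < n → addVec a w (i + 1) ≤ addVec a w i) : IsShape n (addVec a w) := by
  have h0 : ∀ i, n ≤ i → KroneckerLR.addVec a w i = 0 := fun i hi => by
    simp [KroneckerLR.addVec, extc, ha.zero i hi, not_lt.2 hi]
  refine ⟨antitone_nat_of_succ_le fun i => ?_, h0⟩
  by_cases hi : i + 1 < n
  · exact h i hi
  · rw [h0 _ (not_lt.1 hi)]; exact Nat.zero_le _

lemma addVec_injective {n : ℕ} (a : ℕ → ℕ) : Function.Injective (addVec (n := n) a) := by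
  intro v w h
  funext i
  have := congrFun h i
  simpa [addVec, extc] using this

lemma exists_addVec {n : ℕ} {a b : ℕ → ℕ} (ha : IsShape n a) (hb : IsShape n b)
    (h : ∀ i, a i ≤ b i) : ∃ w : Fin n → ℕ, addVec a w = b := by
  refine ⟨fun i => b i - a i, ?_⟩
  funext i
  by_cases hi : i < n
  · simp [addVec, extc, hi, h i]
  · simp [addVec, extc, hi, ha.zero i (not_lt.1 hi), hb.zero i (not_lt.1 hi)]

lemma card_fiber_eq_ite {ι β : Type*} (T : Finset ι) (b : ι → β) (hb : Set.InjOn b T) (l : β)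
    (P : Prop) (hP : P ↔ ∃ t ∈ T, b t = l) : #{t ∈ T | b t = l} = if P then 1 else 0 := by
  split_ifs with h
  · obtain ⟨t, ht, rfl⟩ := hP.1 h
    rw [card_eq_one]
    refine ⟨t, ?_⟩
    ext s
    simp only [mem_filter, mem_singleton]
    exact ⟨fun hs => hb hs.1 ht hs.2, fun hs => by rw [hs]; exact ⟨ht, rfl⟩⟩
  · rw [card_eq_zero, filter_eq_empty_iff]
    exact fun t ht hl => h (hP.2 ⟨t, ht, hl⟩)

/-- Elementary symmetric sums of a family of ring elements. -/
def esum {X R : Type*} [Fintype X] [CommSemiring R] (w : X → R) (c : ℕ) : R :=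
  ∑ S ∈ powersetCard c (univ : Finset X), ∏ x ∈ S, w x

/-- The indicator vector of a set. -/
def ind {n : ℕ} (S : Finset (Fin n)) : Fin n → ℕ := fun i => if i ∈ S then 1 else 0

lemma sum_ind {n : ℕ} (S : Finset (Fin n)) : ∑ i, ind S i = #S := by
  simp [ind]

/-- The variable `X i`, written as a monomial. -/
def var {n : ℕ} (i : Fin n) : MvPolynomial (Fin n) ℚ := mono (Pi.single i 1)

lemma prod_var {n : ℕ} {ι : Type*} (s : Finset ι) (f : ι → Fin n) :
    ∏ i ∈ s, var (f i) = mono fun j => #{i ∈ s | f i = j} := by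
  unfold var
  rw [prod_mono]
  congr 1
  funext j
  simp [Finset.sum_apply, Pi.single_apply, eq_comm]

lemma esum_var (n c : ℕ) :
    esum (var (n := n)) c = ∑ S ∈ powersetCard c (univ : Finset (Fin n)), mono (ind S) := by
  refine sum_congr rfl fun S _ => ?_
  refine (prod_var S id).trans ?_
  congr 1
  funext j
  simp only [id, ind, filter_eq']
  split_ifs <;> simp

lemma alt_mul_esum {n d c : ℕ} {m : ℕ → ℕ} (hm : m ∈ shapes n d) :
    alt (shift n m) * esum var c =
      ∑ l ∈ shapes n (d + c), ((if VertStrip m l then 1 else 0 : ℕ) : ℚ) • alt (shift n l) := by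
  rw [mem_shapes] at hm
  obtain ⟨hm, hd⟩ := hm
  rw [esum_var, alt_mul_sum]
  swap
  · intro σ
    refine sum_nbij' (fun S => S.map σ.symm.toEmbedding) (fun S => S.map σ.toEmbedding) ?_ ?_ ?_ ?_
      ?_
    · intro S; simp
    · intro S; simp
    · intro S _; ext; simp
    · intro S _; ext; simp
    · intro S _
      congr 1
      funext i
      simp [ind]
  simp only [shift_add]
  rw [← sum_filter_of_ne (p := fun S => IsShape n (addVec m (ind S)))]
  swap
  · intro S _ hS
    refine hm.addVec fun i hi => ?_
    by_contra hlt
    refine hS (alt_eq_zero _ (i := ⟨i, by omega⟩) (j := ⟨i + 1, hi⟩) (by simp) ?_)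
    have h1 := hm.anti (Nat.le_succ i)
    simp only [Nat.succ_eq_add_one] at h1
    simp only [addVec, extc, show i < n by omega, hi, dif_pos, ind, shift] at hlt ⊢
    split_ifs at hlt ⊢ <;> omega
  rw [sum_alt_fiberwise (d := d + c)]
  · refine sum_congr rfl fun l hl => ?_
    rw [mem_shapes] at hl
    congr 2
    refine card_fiber_eq_ite _ _ ?_ _ _ ?_
    · intro S _ T _ h
      have := addVec_injective m h
      ext i
      have := congrFun this i
      simp only [ind] at this
      split_ifs at this <;> simp_all
    · constructor
      · intro h
        obtain ⟨w, hw⟩ := exists_addVec hm hl.1 (fun i => (h i).1)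
        have hS : ind {i | w i = 1} = w := by
          funext i
          have := h i
          rw [← hw] at this
          simp only [addVec, extc, Fin.is_lt, dif_pos, Fin.eta] at this
          simp only [ind, mem_filter, mem_univ, true_and]
          split_ifs <;> omega
        refine ⟨({i | w i = 1} : Finset (Fin n)), ?_, by rw [hS, hw]⟩
        rw [mem_filter, hS, hw, mem_powersetCard, ← sum_ind, hS]
        refine ⟨⟨subset_univ _, ?_⟩, hl.1⟩
        have := hl.2
        rw [← hw, size_addVec] at this
        omega
      · rintro ⟨S, -, rfl⟩ i
        simp only [addVec, extc, ind]
        split_ifs <;> omega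
  · intro S hS
    rw [mem_filter, mem_powersetCard] at hS
    rw [mem_shapes]
    exact ⟨hS.2, by rw [size_addVec, sum_ind, hd, hS.1.2]⟩

/-- The complete homogeneous symmetric polynomial of degree `c`. -/
def hpoly (n c : ℕ) : MvPolynomial (Fin n) ℚ :=
  ∑ v ∈ piAntidiag (univ : Finset (Fin n)) c, mono v

/-- The position `i` violates the horizontal strip condition for `addVec m v / m`. -/
def Violates {n : ℕ} (m : ℕ → ℕ) (v : Fin n → ℕ) (i : ℕ) : Prop :=
  i + 1 < n ∧ m i < addVec m v (i + 1)

lemma Violates.lt {n i : ℕ} {m : ℕ → ℕ} {v : Fin n → ℕ} (h : Violates m v i) : i < n :=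
  Nat.lt_of_succ_lt h.1

/-- Exchanges the entries `i` and `i + 1` of `shift n m + v`. -/
def exch {n : ℕ} (m : ℕ → ℕ) (v : Fin n → ℕ) (i : ℕ) : Fin n → ℕ := fun j =>
  if (j : ℕ) = i then addVec m v (i + 1) - m i - 1
  else if (j : ℕ) = i + 1 then addVec m v i + 1 - m (i + 1) else v j

lemma shift_exch {n i : ℕ} {m : ℕ → ℕ} (hm : Antitone m) {v : Fin n → ℕ}
    (h : Violates m v i) :
    shift n m + exch m v i = (shift n m + v) ∘ swap ⟨i, h.lt⟩ ⟨i + 1, h.1⟩ := by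
  have h1 := hm (Nat.le_succ i)
  simp only [Nat.succ_eq_add_one] at h1
  obtain ⟨hi, h2⟩ := h
  funext j
  simp only [Function.comp, Pi.add_apply, shift, exch, swap_apply_def, Fin.ext_iff]
  simp only [addVec, extc, show i < n by omega, hi, dif_pos] at h2 ⊢
  split_ifs with h3 h4
  · simp only [h3]; omega
  · simp only [h4]; omega
  · rfl

lemma sum_eq_of_comp_swap {n : ℕ} {u v w : Fin n → ℕ} {σ : Perm (Fin n)}
    (h : u + w = (u + v) ∘ σ) : ∑ i, w i = ∑ i, v i := by
  have h1 : ∑ i, (u + w) i = ∑ i, (u + v) i := by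
    rw [h]; exact Equiv.sum_comp σ _
  simpa [sum_add_distrib] using h1

lemma violates_exch_iff {n i : ℕ} {m : ℕ → ℕ} {v : Fin n → ℕ} (hm : Antitone m)
    (h : Violates m v i) {j : ℕ} (hj : i ≤ j) : Violates m (exch m v i) j ↔ Violates m v j := by
  unfold Violates
  refine and_congr_right fun hj' => ?_
  obtain ⟨hi, h2⟩ := h
  have h1 := hm (Nat.le_succ i)
  simp only [Nat.succ_eq_add_one] at h1
  rcases hj.eq_or_lt with rfl | hj
  · simp only [addVec, extc, hi, show i < n by omega, dif_pos, exch] at h2 ⊢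
    simp only [show i + 1 ≠ i by omega, if_true, if_false]
    omega
  · simp only [addVec, extc, hj', dif_pos, exch, show j + 1 ≠ i by omega,
      show j + 1 ≠ i + 1 by omega, if_false]

lemma exch_exch {n i : ℕ} {m : ℕ → ℕ} {v : Fin n → ℕ} (hm : Antitone m)
    (h : Violates m v i) : exch m (exch m v i) i = v := by
  have h' := (violates_exch_iff hm h le_rfl).2 h
  have := shift_exch hm h'
  rw [shift_exch hm h] at this
  funext j
  have := congrFun this j
  simpa using this

/-- The largest position violating the horizontal strip condition. -/
def lastViol {n : ℕ} (m : ℕ → ℕ) (v : Fin n → ℕ) : ℕ := Nat.findGreatest (Violates m v) n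

lemma violates_lastViol {n : ℕ} {m : ℕ → ℕ} {v : Fin n → ℕ} (h : ∃ i, Violates m v i) :
    Violates m v (lastViol m v) := by
  obtain ⟨i, hi⟩ := h
  exact Nat.findGreatest_spec hi.lt.le hi

lemma lastViol_exch {n : ℕ} {m : ℕ → ℕ} {v : Fin n → ℕ} (hm : Antitone m)
    (h : ∃ i, Violates m v i) : lastViol m (exch m v (lastViol m v)) = lastViol m v := by
  have h0 := violates_lastViol h
  refine (Nat.findGreatest_eq_iff).2 ⟨h0.lt.le, fun _ => (violates_exch_iff hm h0 le_rfl).2 h0, ?_⟩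
  intro j hj hjn hv
  rw [violates_exch_iff hm h0 hj.le] at hv
  exact absurd (Nat.le_findGreatest hjn hv) (not_le.2 hj)

lemma alt_mul_hpoly {n d c : ℕ} {m : ℕ → ℕ} (hm : m ∈ shapes n d) :
    alt (shift n m) * hpoly n c =
      ∑ l ∈ shapes n (d + c), ((if HorizStrip m l then 1 else 0 : ℕ) : ℚ) • alt (shift n l) := by
  rw [mem_shapes] at hm
  obtain ⟨hm, hd⟩ := hm
  unfold hpoly
  rw [alt_mul_sum]
  swap
  · intro σ
    refine sum_nbij' (fun v => v ∘ σ) (fun v => v ∘ σ.symm) ?_ ?_ ?_ ?_ ?_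
    · intro v hv
      simp only [mem_piAntidiag, mem_univ, implies_true, and_true, Function.comp] at hv ⊢
      rw [← hv]; exact Equiv.sum_comp σ _
    · intro v hv
      simp only [mem_piAntidiag, mem_univ, implies_true, and_true, Function.comp] at hv ⊢
      rw [← hv]; exact Equiv.sum_comp σ.symm _
    · intro v _; funext; simp
    · intro v _; funext; simp
    · intro v _; rfl
  rw [← sum_filter_add_sum_filter_not _ (fun v => ∃ i, Violates m v i)]
  rw [sum_involution (fun v _ => exch m v (lastViol m v)), zero_add]
  · simp only [shift_add]
    have hgood : ∀ v : Fin n → ℕ, ¬ (∃ i, Violates m v i) → ∀ i,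
        addVec m v (i + 1) ≤ m i := by
      intro v hv i
      by_contra hlt
      by_cases hi : i + 1 < n
      · exact hv ⟨i, hi, not_le.1 hlt⟩
      · simp [addVec, extc, hi, hm.zero _ (not_lt.1 hi)] at hlt
    have hle : ∀ (v : Fin n → ℕ) i, m i ≤ addVec m v i := fun v i => Nat.le_add_right _ _
    rw [sum_alt_fiberwise (d := d + c)]
    · refine sum_congr rfl fun l hl => ?_
      rw [mem_shapes] at hl
      congr 2
      refine card_fiber_eq_ite _ _ (addVec_injective m).injOn _ _ ?_
      constructor
      · intro h
        obtain ⟨w, rfl⟩ := exists_addVec hm hl.1 (fun i => (h i).1)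
        refine ⟨w, ?_, rfl⟩
        rw [mem_filter, mem_piAntidiag]
        refine ⟨⟨?_, by simp⟩, fun ⟨i, hi⟩ => absurd (h i).2 (not_le.2 hi.2)⟩
        have := hl.2
        rw [size_addVec] at this
        change ∑ i, w i = c
        omega
      · rintro ⟨v, hv, rfl⟩ i
        exact ⟨hle v i, hgood v (mem_filter.1 hv).2 i⟩
    · intro v hv
      rw [mem_filter, mem_piAntidiag] at hv
      rw [mem_shapes, size_addVec, hd, hv.1.1]
      exact ⟨hm.addVec fun i _ => (hgood v hv.2 i).trans (hle v i), rfl⟩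
  · intro v hv
    have h := violates_lastViol (mem_filter.1 hv).2
    rw [shift_exch hm.anti h, alt_comp_swap _ (by simp), add_neg_cancel]
  · intro v hv hne heq
    have h := violates_lastViol (mem_filter.1 hv).2
    have h2 := shift_exch hm.anti h
    have h3 := alt_comp_swap (shift n m + v) (i := ⟨_, h.lt⟩) (j := ⟨_, h.1⟩) (by simp)
    rw [heq] at h2
    rw [← h2] at h3
    exact hne (self_eq_neg.1 h3)
  · intro v hv
    rw [mem_filter] at hv ⊢
    have h := violates_lastViol hv.2
    have hv1 := hv.1
    simp only [mem_piAntidiag, mem_univ, implies_true, and_true] at hv1 ⊢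
    refine ⟨?_, _, (violates_exch_iff hm.anti h le_rfl).2 h⟩
    rw [← hv1]
    exact sum_eq_of_comp_swap (shift_exch hm.anti h)
  · intro v hv
    have h := (mem_filter.1 hv).2
    simp only [lastViol_exch hm.anti h]
    exact exch_exch hm.anti (violates_lastViol h)

/-! ### Gelfand–Tsetlin patterns and Schur polynomials -/

lemma size_succ (n : ℕ) (a : ℕ → ℕ) : size (n + 1) a = size n a + a n := sum_range_succ _ _

lemma size_congr {n : ℕ} {a b : ℕ → ℕ} (h : ∀ k < n, a k = b k) : size n a = size n b :=
  sum_congr rfl fun k hk => h k (mem_range.1 hk)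

lemma size_mono {n : ℕ} {a b : ℕ → ℕ} (h : ∀ k, a k ≤ b k) : size n a ≤ size n b :=
  sum_le_sum fun k _ => h k

/-- `p` is a Gelfand–Tsetlin pattern of shape `l`: a chain of horizontal strips. -/
structure IsGT (n : ℕ) (l : ℕ → ℕ) (p : ℕ → ℕ → ℕ) : Prop where
  zero : ∀ k, p 0 k = 0
  last : ∀ i, n ≤ i → p i = l
  strip : ∀ i, HorizStrip (p i) (p (i + 1))

namespace IsGT
variable {n : ℕ} {l : ℕ → ℕ} {p : ℕ → ℕ → ℕ}

lemma mono (h : IsGT n l p) (k : ℕ) : Monotone fun i => p i k :=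
  monotone_nat_of_le_succ fun i => (h.strip i k).1

lemma le (h : IsGT n l p) (i k : ℕ) : p i k ≤ l k := by
  have := h.mono k (le_max_left i n)
  rwa [← h.last (max i n) (le_max_right _ _)]

lemma eq_zero (h : IsGT n l p) (i k : ℕ) (hik : i ≤ k) : p i k = 0 := by
  induction i generalizing k with
  | zero => exact h.zero k
  | succ i ih =>
    obtain ⟨k, rfl⟩ : ∃ m, k = m + 1 := ⟨k - 1, by omega⟩
    exact Nat.le_zero.1 ((h.strip i k).2.trans (ih k (by omega)).le)

lemma isShape (h : IsGT n l p) : IsShape n l := by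
  refine ⟨antitone_nat_of_succ_le fun k => ?_, fun k hk => ?_⟩
  · have := (h.strip n k).2
    rwa [h.last _ le_rfl, h.last _ (Nat.le_succ n)] at this
  · rw [← h.last n le_rfl]; exact h.eq_zero n k hk

lemma eq_zero' (h : IsGT n l p) (i k : ℕ) (hk : n ≤ k) : p i k = 0 :=
  Nat.le_zero.1 ((h.le i k).trans (h.isShape.zero k hk).le)

lemma size_mono (h : IsGT n l p) : Monotone fun i => size n (p i) :=
  monotone_nat_of_le_succ fun i => KroneckerLR.size_mono fun k => (h.strip i k).1

lemma size_zero (h : IsGT n l p) (m : ℕ) : size m (p 0) = 0 :=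
  sum_eq_zero fun k _ => h.zero k

end IsGT

lemma finite_isGT (n : ℕ) (l : ℕ → ℕ) : {p | IsGT n l p}.Finite := by
  refine Set.Finite.of_finite_image (f := fun p => fun (i k : Fin n) => p i k) ?_ ?_
  · refine (Set.Finite.pi' (ι := Fin n) (t := fun _ => {f : Fin n → ℕ | ∀ k : Fin n, f k ∈ Set.Iic (l k)})
      fun _ => Set.Finite.pi' (t := fun k : Fin n => Set.Iic (l k))
        fun k => Set.finite_Iic (l k)).subset ?_
    rintro _ ⟨p, hp, rfl⟩ i k
    exact IsGT.le hp i k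
  · intro p hp q hq hpq
    funext i k
    by_cases hi : i < n
    · by_cases hk : k < n
      · exact congrFun (congrFun hpq ⟨i, hi⟩) ⟨k, hk⟩
      · rw [IsGT.eq_zero' hp i k (not_lt.1 hk), IsGT.eq_zero' hq i k (not_lt.1 hk)]
    · rw [IsGT.last hp i (not_lt.1 hi), IsGT.last hq i (not_lt.1 hi)]

/-- The set of Gelfand–Tsetlin patterns of shape `l`. -/
def patterns (n : ℕ) (l : ℕ → ℕ) : Finset (ℕ → ℕ → ℕ) := (finite_isGT n l).toFinset

lemma mem_patterns {n : ℕ} {l : ℕ → ℕ} {p : ℕ → ℕ → ℕ} : p ∈ patterns n l ↔ IsGT n l p := by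
  simp [patterns]

/-- The weight of a pattern. -/
def wt (n : ℕ) (p : ℕ → ℕ → ℕ) : Fin n → ℕ := fun i => size n (p (i + 1)) - size n (p i)

/-- The Schur polynomial of shape `l` in `n` variables. -/
def schur (n : ℕ) (l : ℕ → ℕ) : MvPolynomial (Fin n) ℚ := ∑ p ∈ patterns n l, mono (wt n p)

lemma sum_wt {n : ℕ} {l : ℕ → ℕ} {p : ℕ → ℕ → ℕ} (h : IsGT n l p) :
    ∑ i, wt n p i = size n l := by
  have := sum_range_tsub h.size_mono n
  rw [h.size_zero, Nat.sub_zero, h.last n le_rfl] at this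
  rw [← this, sum_range]
  rfl

/-! ### Bender–Knuth toggles -/

/-- Lower end of the interval allowed between the levels `a` and `b`. -/
def lo (a b : ℕ → ℕ) (k : ℕ) : ℕ := max (a k) (b (k + 1))

/-- Upper end of the interval allowed between the levels `a` and `b`. -/
def hi (a b : ℕ → ℕ) (k : ℕ) : ℕ := if k = 0 then b 0 else min (a (k - 1)) (b k)

lemma horizStrip_and_iff {a p b : ℕ → ℕ} :
    HorizStrip a p ∧ HorizStrip p b ↔ ∀ k, lo a b k ≤ p k ∧ p k ≤ hi a b k := by
  constructor
  · rintro ⟨h1, h2⟩ k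
    refine ⟨max_le (h1 k).1 (h2 k).2, ?_⟩
    rcases k with _ | k
    · simpa [hi] using (h2 0).1
    · simpa [hi] using ⟨(h1 k).2, (h2 (k + 1)).1⟩
  · intro h
    refine ⟨fun k => ⟨(le_max_left _ _).trans (h k).1, ?_⟩,
      fun k => ⟨?_, (le_max_right _ _).trans (h k).1⟩⟩
    · have := (h (k + 1)).2
      simp only [hi, Nat.succ_ne_zero, if_false, Nat.add_sub_cancel, le_min_iff] at this
      exact this.1
    · refine (h k).2.trans ?_
      rcases k with _ | k <;> simp [hi]

lemma lo_add_hi (a b : ℕ → ℕ) (k : ℕ) : lo a b k + hi a b (k + 1) = a k + b (k + 1) := by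
  simp only [lo, hi, Nat.succ_ne_zero, if_false, Nat.add_sub_cancel]
  exact max_add_min _ _

lemma size_lo_add_size_hi (a b : ℕ → ℕ) (m : ℕ) :
    size m (lo a b) + size (m + 1) (hi a b) = size m a + size (m + 1) b := by
  induction m with
  | zero => simp [size, hi]
  | succ m ih =>
    rw [size_succ m (lo a b), size_succ (m + 1) (hi a b), size_succ m a, size_succ (m + 1) b]
    have := lo_add_hi a b m
    omega

/-- Reflects the entries of `p` of index at least `K`, shifting the entry `K` by `x`. -/
def flip (a b p : ℕ → ℕ) (K x : ℕ) : ℕ → ℕ := fun k =>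
  if k < K then p k
  else if k = K then lo a b k + hi a b k - p k - x else lo a b k + hi a b k - p k

lemma flip_mem {a b p : ℕ → ℕ} {K x : ℕ} (h : ∀ k, lo a b k ≤ p k ∧ p k ≤ hi a b k)
    (hx : x + p K ≤ hi a b K) (k : ℕ) :
    lo a b k ≤ flip a b p K x k ∧ flip a b p K x k ≤ hi a b k := by
  have := h k
  unfold flip
  split_ifs with h1 h2
  · exact this
  · subst h2; omega
  · omega

lemma flip_flip {a b p : ℕ → ℕ} {K x : ℕ} (h : ∀ k, lo a b k ≤ p k ∧ p k ≤ hi a b k)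
    (hx : x + p K ≤ hi a b K) : flip a b (flip a b p K x) K x = p := by
  funext k
  have := h k
  unfold flip
  split_ifs with h1 h2
  · rfl
  · subst h2; omega
  · omega

lemma size_flip {a b p : ℕ → ℕ} {K x : ℕ} (h : ∀ k, lo a b k ≤ p k ∧ p k ≤ hi a b k)
    (hx : x + p K ≤ hi a b K) {N : ℕ} (hN : K + 1 ≤ N) :
    size N (flip a b p K x) + size N p + x + (size K (lo a b) + size K (hi a b)) =
      size N (lo a b) + size N (hi a b) + 2 * size K p := by
  induction N, hN using Nat.le_induction with
  | base =>
    have h1 : size K (flip a b p K x) = size K p := size_congr fun k hk => by simp [flip, hk]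
    have := h K
    simp only [size_succ, h1]
    simp only [flip, lt_irrefl, if_true, if_false]
    omega
  | succ N hN ih =>
    have := h N
    have h2 : flip a b p K x N = lo a b N + hi a b N - p N := by
      simp [flip, show ¬ N < K by omega, show N ≠ K by omega]
    simp only [size_succ _ (flip a b p K x), size_succ _ p, size_succ _ (lo a b),
      size_succ _ (hi a b), h2] at ih ⊢
    omega

/-- Toggles the level `i + 1` of a pattern. -/
def toggle (p : ℕ → ℕ → ℕ) (i K x : ℕ) : ℕ → ℕ → ℕ :=
  Function.update p (i + 1) (flip (p i) (p (i + 2)) (p (i + 1)) K x)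

lemma toggle_self (p : ℕ → ℕ → ℕ) (i K x : ℕ) :
    toggle p i K x (i + 1) = flip (p i) (p (i + 2)) (p (i + 1)) K x := by simp [toggle]

lemma toggle_of_ne (p : ℕ → ℕ → ℕ) (i K x : ℕ) {j : ℕ} (h : j ≠ i + 1) :
    toggle p i K x j = p j := by simp [toggle, h]

lemma IsGT.between {n : ℕ} {l : ℕ → ℕ} {p : ℕ → ℕ → ℕ} (h : IsGT n l p) (i k : ℕ) :
    lo (p i) (p (i + 2)) k ≤ p (i + 1) k ∧ p (i + 1) k ≤ hi (p i) (p (i + 2)) k :=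
  horizStrip_and_iff.1 ⟨h.strip i, h.strip (i + 1)⟩ k

lemma IsGT.toggle {n : ℕ} {l : ℕ → ℕ} {p : ℕ → ℕ → ℕ} (h : IsGT n l p) {i K x : ℕ}
    (hi' : i + 1 < n) (hx : x + p (i + 1) K ≤ hi (p i) (p (i + 2)) K) :
    IsGT n l (toggle p i K x) := by
  have h1 := horizStrip_and_iff.2 (flip_mem (h.between i) hx)
  refine ⟨fun k => ?_, fun j hj => ?_, fun j => ?_⟩
  · rw [toggle_of_ne _ _ _ _ (by omega), h.zero]
  · rw [toggle_of_ne _ _ _ _ (by omega), h.last j hj]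
  · by_cases h2 : j = i
    · subst h2
      rw [toggle_self, toggle_of_ne _ _ _ _ (by omega)]
      exact h1.1
    · by_cases h3 : j = i + 1
      · subst h3
        rw [toggle_self, toggle_of_ne _ _ _ _ (by omega)]
        exact h1.2
      · rw [toggle_of_ne _ _ _ _ h3, toggle_of_ne _ _ _ _ (by omega)]
        exact h.strip j

lemma toggle_toggle {n : ℕ} {l : ℕ → ℕ} {p : ℕ → ℕ → ℕ} (h : IsGT n l p) {i K x : ℕ}
    (hx : x + p (i + 1) K ≤ hi (p i) (p (i + 2)) K) :
    toggle (toggle p i K x) i K x = p := by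
  funext j
  by_cases hj : j = i + 1
  · subst hj
    rw [toggle_self, toggle_self, toggle_of_ne _ _ _ _ (by omega),
      toggle_of_ne _ _ _ _ (by omega), flip_flip (h.between i) hx]
  · rw [toggle_of_ne _ _ _ _ hj, toggle_of_ne _ _ _ _ hj]

lemma size_toggle {n : ℕ} {l : ℕ → ℕ} {p : ℕ → ℕ → ℕ} (h : IsGT n l p) {i K x : ℕ}
    (hK : K < n) (hx : x + p (i + 1) K ≤ hi (p i) (p (i + 2)) K) :
    size n (toggle p i K x (i + 1)) + size n (p (i + 1)) + x +
        (size K (lo (p i) (p (i + 2))) + size K (hi (p i) (p (i + 2)))) =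
      size n (p i) + size n (p (i + 2)) + 2 * size K (p (i + 1)) := by
  rw [toggle_self, size_flip (h.between i) hx hK]
  have h1 := size_lo_add_size_hi (p i) (p (i + 2)) n
  have h2 : hi (p i) (p (i + 2)) n = 0 := by
    simp only [hi, show n ≠ 0 by omega, if_false, h.eq_zero' (i + 2) n le_rfl]
    exact Nat.min_zero _
  rw [size_succ, size_succ, h2, h.eq_zero' (i + 2) n le_rfl] at h1
  omega

lemma wt_toggle {n : ℕ} {l : ℕ → ℕ} {p q : ℕ → ℕ → ℕ} (hp : IsGT n l p) (hq : IsGT n l q)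
    {i t : ℕ} (hi' : i + 1 < n) (hne : ∀ j, j ≠ i + 1 → q j = p j) (u : Fin n → ℕ)
    (hu : u ⟨i, by omega⟩ = u ⟨i + 1, hi'⟩ + t)
    (ht : size n (q (i + 1)) + size n (p (i + 1)) + t = size n (p i) + size n (p (i + 2))) :
    u + wt n q = (u + wt n p) ∘ swap ⟨i, by omega⟩ ⟨i + 1, hi'⟩ := by
  have h1 := hp.size_mono (Nat.le_succ i)
  have h2 := hp.size_mono (Nat.le_succ (i + 1))
  have h3 := hq.size_mono (Nat.le_succ i)
  have h4 := hq.size_mono (Nat.le_succ (i + 1))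
  simp only [Nat.succ_eq_add_one] at h1 h2 h3 h4
  have e1 := hne i (by omega)
  have e2 := hne (i + 2) (by omega)
  simp only [add_assoc, Nat.reduceAdd] at h1 h2 h3 h4
  rw [e1] at h3
  rw [e2] at h4
  funext j
  simp only [Function.comp, Pi.add_apply, wt, swap_apply_def, Fin.ext_iff]
  split_ifs with h5 h6
  · obtain ⟨j, hj⟩ := j
    simp only at h5
    subst h5
    simp only [add_assoc, Nat.reduceAdd, e1]
    omega
  · obtain ⟨j, hj⟩ := j
    simp only at h6
    subst h6
    simp only [add_assoc, Nat.reduceAdd, e2]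
    omega
  · rw [hne j h6, hne (j + 1) (by omega)]

lemma sum_patterns_comp {n : ℕ} (l : ℕ → ℕ) {M : Type*} [AddCommMonoid M] (σ : Perm (Fin n))
    (G : (Fin n → ℕ) → M) :
    ∑ p ∈ patterns n l, G (wt n p ∘ σ) = ∑ p ∈ patterns n l, G (wt n p) := by
  rcases n with _ | n
  · rw [Subsingleton.elim σ 1]; rfl
  have hσ : σ ∈ Submonoid.closure (Set.range fun i : Fin n => swap i.castSucc i.succ) := by
    rw [Perm.mclosure_swap_castSucc_succ]; trivial
  induction hσ using Submonoid.closure_induction generalizing G with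
  | one => rfl
  | mul σ τ _ _ h1 h2 => exact (h1 fun w => G (w ∘ τ)).trans (h2 G)
  | mem τ hτ =>
    obtain ⟨i, rfl⟩ := hτ
    have hx : ∀ p ∈ patterns (n + 1) l,
        0 + p ((i : ℕ) + 1) 0 ≤ hi (p i) (p ((i : ℕ) + 2)) 0 := fun p hp => by
      rw [zero_add]; exact ((mem_patterns.1 hp).between i 0).2
    have hm : ∀ p ∈ patterns (n + 1) l, toggle p i 0 0 ∈ patterns (n + 1) l := fun p hp =>
      mem_patterns.2 ((mem_patterns.1 hp).toggle (by have := i.2; omega) (hx p hp))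
    refine sum_nbij' (fun p => toggle p i 0 0) (fun p => toggle p i 0 0) hm hm
      (fun p hp => toggle_toggle (mem_patterns.1 hp) (hx p hp))
      (fun p hp => toggle_toggle (mem_patterns.1 hp) (hx p hp)) fun p hp => ?_
    have h1 := size_toggle (mem_patterns.1 hp) (Nat.succ_pos n) (hx p hp)
    have h2 := wt_toggle (t := 0) (mem_patterns.1 hp) (mem_patterns.1 (hm p hp))
      (show (i : ℕ) + 1 < n + 1 by have := i.2; omega)
      (fun j hj => toggle_of_ne p i 0 0 hj) 0 rfl
      (by simp only [size, range_zero, sum_empty] at h1 ⊢; omega)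
    rw [zero_add, zero_add] at h2
    rw [h2]
    rfl

/-! ### The Littlewood–Richardson rule -/

/-- Reading the increments of `p` as rows of a skew filling with inner shape `m`, the entry
`k` of row `i + 1` violates column strictness. -/
def BadAt (n : ℕ) (m : ℕ → ℕ) (p : ℕ → ℕ → ℕ) (k i : ℕ) : Prop :=
  i + 1 < n ∧ m i + size k (p (i + 1)) + size (k + 1) (p (i + 1)) <
    m (i + 1) + size (k + 1) (p (i + 2)) + size k (p i)

/-- The patterns describing Littlewood–Richardson fillings with inner shape `m`. -/
def Good (n : ℕ) (m : ℕ → ℕ) (p : ℕ → ℕ → ℕ) : Prop := ∀ k i, ¬ BadAt n m p k i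

/-- The first entry violating column strictness. -/
def badEntry (n : ℕ) (m : ℕ → ℕ) (p : ℕ → ℕ → ℕ) : ℕ := sInf {k | ∃ i, BadAt n m p k i}

/-- The last row in which the first bad entry occurs. -/
def badRow (n : ℕ) (m : ℕ → ℕ) (p : ℕ → ℕ → ℕ) : ℕ :=
  Nat.findGreatest (BadAt n m p (badEntry n m p)) n

lemma badAt_badRow {n : ℕ} {m : ℕ → ℕ} {p : ℕ → ℕ → ℕ} (h : ¬ Good n m p) :
    BadAt n m p (badEntry n m p) (badRow n m p) := by
  simp only [Good, not_forall, not_not] at h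
  obtain ⟨i, hi⟩ : ∃ i, BadAt n m p (badEntry n m p) i :=
    Nat.sInf_mem (s := {k | ∃ i, BadAt n m p k i}) h
  exact Nat.findGreatest_spec (Nat.lt_of_succ_lt hi.1).le hi

lemma not_badAt_of_lt {n k i : ℕ} {m : ℕ → ℕ} {p : ℕ → ℕ → ℕ} (h : k < badEntry n m p) :
    ¬ BadAt n m p k i := fun hb =>
  Nat.notMem_of_lt_sInf (s := {k | ∃ i, BadAt n m p k i}) h ⟨i, hb⟩

lemma bad_eq {n K i : ℕ} {m : ℕ → ℕ} {p : ℕ → ℕ → ℕ} (h : BadAt n m p K i)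
    (hK : ∀ k < K, ∀ j, ¬ BadAt n m p k j) (hi : ∀ j, i < j → ¬ BadAt n m p K j) :
    badEntry n m p = K ∧ badRow n m p = i := by
  have h1 : badEntry n m p = K := by
    refine le_antisymm (Nat.sInf_le ⟨i, h⟩) ?_
    by_contra hlt
    obtain ⟨j, hj⟩ : ∃ j, BadAt n m p (badEntry n m p) j :=
      Nat.sInf_mem (s := {k | ∃ i, BadAt n m p k i}) ⟨K, i, h⟩
    exact hK _ (not_le.1 hlt) j hj
  refine ⟨h1, ?_⟩
  rw [badRow, h1]
  exact Nat.findGreatest_eq_iff.2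
    ⟨(Nat.lt_of_succ_lt h.1).le, fun _ => h, fun j hj _ => hi j hj⟩

lemma badEntry_lt {n l' : ℕ} {l m : ℕ → ℕ} {p : ℕ → ℕ → ℕ} (hp : IsGT n l p)
    (h : BadAt n m p (badEntry n m p) l') : badEntry n m p < n := by
  by_contra hn
  obtain ⟨k, hk⟩ : ∃ k, badEntry n m p = k + 1 := ⟨badEntry n m p - 1, by have := h.1; omega⟩
  have h1 : ¬ BadAt n m p k l' := not_badAt_of_lt (by omega)
  rw [hk] at h
  have h2 := h.1
  have e1 := hp.eq_zero' (l' + 1) (k + 1) (by omega)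
  have e2 := hp.eq_zero' (l' + 2) (k + 1) (by omega)
  have e3 := (hp.strip l' k).1
  simp only [BadAt, size_succ, e1, e2, not_and] at h h1
  have := h1 h2
  omega

/-- The amount by which the toggled level is moved at the first bad entry. -/
def badShift (m : ℕ → ℕ) (p : ℕ → ℕ → ℕ) (K i : ℕ) : ℕ :=
  m i + 1 + 2 * size K (p (i + 1)) + hi (p i) (p (i + 2)) K -
    (m (i + 1) + size K (p i) + size (K + 1) (p (i + 2)))

lemma badShift_spec {n i : ℕ} {l m : ℕ → ℕ} {p : ℕ → ℕ → ℕ} (hm : Antitone m) (hp : IsGT n l p)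
    (h : BadAt n m p (badEntry n m p) i) :
    badShift m p (badEntry n m p) i +
        (m (i + 1) + size (badEntry n m p) (p i) + size (badEntry n m p + 1) (p (i + 2))) =
      m i + 1 + 2 * size (badEntry n m p) (p (i + 1)) + hi (p i) (p (i + 2)) (badEntry n m p) := by
  refine Nat.sub_add_cancel ?_
  rcases hK : badEntry n m p with _ | k
  · have := hm (Nat.le_succ i)
    simp only [Nat.succ_eq_add_one] at this
    simp [size, hi]
    omega
  · have h1 : ¬ BadAt n m p k i := not_badAt_of_lt (by omega)
    have h2 := h.1
    simp only [BadAt, not_and, not_lt] at h1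
    have h1 := h1 h2
    have h3 := (hp.between i k).1
    have h4 := lo_add_hi (p i) (p (i + 2)) k
    simp only [size_succ] at h1 ⊢
    omega

lemma badShift_le {n i : ℕ} {l m : ℕ → ℕ} {p : ℕ → ℕ → ℕ} (hm : Antitone m) (hp : IsGT n l p)
    (h : BadAt n m p (badEntry n m p) i) :
    badShift m p (badEntry n m p) i + p (i + 1) (badEntry n m p) ≤
      hi (p i) (p (i + 2)) (badEntry n m p) := by
  have h1 := badShift_spec hm hp h
  have h2 := h.2
  rw [size_succ _ (p (i + 1))] at h2
  omega

/-- The sign-reversing involution on bad patterns. -/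
def badToggle (n : ℕ) (m : ℕ → ℕ) (p : ℕ → ℕ → ℕ) : ℕ → ℕ → ℕ :=
  toggle p (badRow n m p) (badEntry n m p) (badShift m p (badEntry n m p) (badRow n m p))

section
variable {n : ℕ} {l m : ℕ → ℕ} {p : ℕ → ℕ → ℕ}

lemma badToggle_isGT (hm : Antitone m) (hp : IsGT n l p) (h : ¬ Good n m p) :
    IsGT n l (badToggle n m p) :=
  hp.toggle (badAt_badRow h).1 (badShift_le hm hp (badAt_badRow h))

lemma size_badToggle (i : ℕ) {k : ℕ} (hk : k ≤ badEntry n m p) :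
    size k (badToggle n m p i) = size k (p i) := by
  by_cases hi : i = badRow n m p + 1
  · subst hi
    rw [badToggle, toggle_self]
    exact size_congr fun j hj => by simp [flip, hj.trans_le hk]
  · rw [badToggle, toggle_of_ne _ _ _ _ hi]

lemma badToggle_spec (hm : Antitone m) (hp : IsGT n l p) (h : ¬ Good n m p) :
    BadAt n m (badToggle n m p) (badEntry n m p) (badRow n m p) ∧
      badEntry n m (badToggle n m p) = badEntry n m p ∧
      badRow n m (badToggle n m p) = badRow n m p := by
  have hb := badAt_badRow h
  have h0 : BadAt n m (badToggle n m p) (badEntry n m p) (badRow n m p) := by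
    refine ⟨hb.1, ?_⟩
    have h1 := badShift_spec hm hp hb
    have h2 := badShift_le hm hp hb
    have h3 := hp.between (badRow n m p) (badEntry n m p)
    rw [size_succ _ (badToggle n m p (badRow n m p + 1)), size_badToggle _ le_rfl,
      size_badToggle _ le_rfl]
    have e1 : badToggle n m p (badRow n m p + 2) = p (badRow n m p + 2) :=
      toggle_of_ne _ _ _ _ (by omega)
    have e2 : badToggle n m p (badRow n m p + 1) (badEntry n m p) =
        lo (p (badRow n m p)) (p (badRow n m p + 2)) (badEntry n m p) +
          hi (p (badRow n m p)) (p (badRow n m p + 2)) (badEntry n m p) -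
          p (badRow n m p + 1) (badEntry n m p) -
          badShift m p (badEntry n m p) (badRow n m p) := by
      rw [badToggle, toggle_self]
      simp [flip]
    rw [e1, e2]
    omega
  refine ⟨h0, bad_eq h0 (fun k hk j hj => ?_) fun j hj hj' => ?_⟩
  · refine not_badAt_of_lt hk (i := j) ⟨hj.1, ?_⟩
    have := hj.2
    rwa [size_badToggle _ hk.le, size_badToggle _ hk.le, size_badToggle _ hk,
      size_badToggle _ hk] at this
  · have h1 : ¬ BadAt n m p (badEntry n m p) j := Nat.findGreatest_is_greatest hj
      (Nat.lt_of_succ_lt hj'.1).le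
    refine h1 ⟨hj'.1, ?_⟩
    have := hj'.2
    rw [size_badToggle _ le_rfl, size_badToggle _ le_rfl] at this
    rwa [badToggle, toggle_of_ne _ _ _ _ (by omega), toggle_of_ne _ _ _ _ (by omega)] at this

lemma badToggle_badToggle (hm : Antitone m) (hp : IsGT n l p) (h : ¬ Good n m p) :
    badToggle n m (badToggle n m p) = p := by
  obtain ⟨-, h1, h2⟩ := badToggle_spec hm hp h
  have h3 : badShift m (badToggle n m p) (badEntry n m p) (badRow n m p) =
      badShift m p (badEntry n m p) (badRow n m p) := by
    rw [badShift, size_badToggle _ le_rfl, size_badToggle _ le_rfl]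
    have e1 : badToggle n m p (badRow n m p + 2) = p (badRow n m p + 2) :=
      toggle_of_ne _ _ _ _ (by omega)
    have e2 : badToggle n m p (badRow n m p) = p (badRow n m p) :=
      toggle_of_ne _ _ _ _ (by omega)
    rw [e1, e2, badShift]
  conv_lhs => rw [badToggle]
  rw [h1, h2, h3]
  exact toggle_toggle hp (badShift_le hm hp (badAt_badRow h))

lemma shift_badToggle (hm : Antitone m) (hp : IsGT n l p) (h : ¬ Good n m p) :
    ∃ i j : Fin n, i ≠ j ∧
      shift n m + wt n (badToggle n m p) = (shift n m + wt n p) ∘ swap i j := by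
  have hb := badAt_badRow h
  have hK := badEntry_lt hp hb
  have h1 := badShift_spec hm hp hb
  have h2 := size_toggle hp hK (badShift_le hm hp hb)
  have h3 := size_lo_add_size_hi (p (badRow n m p)) (p (badRow n m p + 2)) (badEntry n m p)
  have h4 := hm (Nat.le_succ (badRow n m p))
  have h5 := hb.1
  simp only [Nat.succ_eq_add_one] at h4
  rw [size_succ _ (hi _ _)] at h3
  refine ⟨_, _, ?_, wt_toggle (t := m (badRow n m p) + 1 - m (badRow n m p + 1)) hp
    (badToggle_isGT hm hp h) hb.1 (fun j hj => toggle_of_ne _ _ _ _ hj) (shift n m) ?_ ?_⟩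
  · simp
  · simp only [shift]
    omega
  · change size n (toggle _ _ _ _ _) + _ + _ = _
    omega

lemma Good.isShape (hm : IsShape n m) (hp : IsGT n l p) (h : Good n m p) :
    IsShape n (addVec m (wt n p)) := by
  refine hm.addVec fun i hi => ?_
  have h1 : ¬ BadAt n m p n i := h n i
  simp only [BadAt, not_and, not_lt, size_succ, hp.eq_zero' _ n le_rfl] at h1
  have h1 := h1 hi
  have h2 := hp.size_mono (Nat.le_succ i)
  have h3 := hp.size_mono (Nat.le_succ (i + 1))
  simp only [Nat.succ_eq_add_one, add_assoc, Nat.reduceAdd] at h2 h3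
  simp only [addVec, extc, hi, Nat.lt_of_succ_lt hi, dif_pos, wt, add_assoc, Nat.reduceAdd]
  omega

end

/-- The Littlewood–Richardson coefficient, as a number of patterns. -/
def lrPat (n : ℕ) (l m a : ℕ → ℕ) : ℕ :=
  #{p ∈ patterns n l | Good n m p ∧ addVec m (wt n p) = a}

lemma alt_mul_schur {n d : ℕ} {m : ℕ → ℕ} (hm : m ∈ shapes n d) (l : ℕ → ℕ) :
    alt (shift n m) * schur n l =
      ∑ a ∈ shapes n (d + size n l), (lrPat n l m a : ℚ) • alt (shift n a) := by
  rw [mem_shapes] at hm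
  obtain ⟨hm, hd⟩ := hm
  unfold schur lrPat
  rw [alt_mul_sum _ _ fun σ => sum_patterns_comp l σ mono]
  rw [← sum_filter_not_add_sum_filter _ (fun p => Good n m p)]
  rw [sum_involution (fun p _ => badToggle n m p), zero_add]
  · simp only [shift_add]
    rw [sum_alt_fiberwise (d := d + size n l)]
    · simp only [filter_filter]
    · intro p hp
      rw [mem_filter, mem_patterns] at hp
      rw [mem_shapes, size_addVec, hd, sum_wt hp.1]
      exact ⟨hp.2.isShape hm hp.1, rfl⟩
  · intro p hp
    rw [mem_filter, mem_patterns] at hp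
    obtain ⟨i, j, hij, h⟩ := shift_badToggle hm.anti hp.1 hp.2
    rw [h, alt_comp_swap _ hij, add_neg_cancel]
  · intro p hp hne heq
    rw [mem_filter, mem_patterns] at hp
    obtain ⟨i, j, hij, h⟩ := shift_badToggle hm.anti hp.1 hp.2
    have h3 := alt_comp_swap (shift n m + wt n p) hij
    rw [← h, heq] at h3
    exact hne (self_eq_neg.1 h3)
  · intro p hp
    rw [mem_filter, mem_patterns] at hp ⊢
    exact ⟨badToggle_isGT hm.anti hp.1 hp.2,
      fun hg => hg _ _ (badToggle_spec hm.anti hp.1 hp.2).1⟩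
  · intro p hp
    rw [mem_filter, mem_patterns] at hp
    exact badToggle_badToggle hm.anti hp.1 hp.2

/-! ### The bialternant formula -/

/-- The pattern whose `i`-th level consists of the first `i` parts of `l`. -/
def topPattern (l : ℕ → ℕ) : ℕ → ℕ → ℕ := fun i k => if k < i then l k else 0

lemma size_topPattern (l : ℕ → ℕ) (k i : ℕ) : size k (topPattern l i) = size (min k i) l := by
  simp only [size, topPattern, ← sum_filter]
  refine sum_congr ?_ fun _ _ => rfl
  ext; simp

section
variable {n : ℕ} {l : ℕ → ℕ}

lemma isGT_topPattern (h : IsShape n l) : IsGT n l (topPattern l) := by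
  refine ⟨fun k => by simp [topPattern], fun i hi => ?_, fun i k => ?_⟩
  · funext k
    simp only [topPattern]
    split_ifs with h1
    · rfl
    · exact (h.zero k (by omega)).symm
  · have := h.anti (Nat.le_succ k)
    simp only [Nat.succ_eq_add_one] at this
    simp only [topPattern]
    constructor <;> split_ifs <;> omega

lemma good_topPattern (h : IsShape n l) : Good n 0 (topPattern l) := by
  rintro k i ⟨-, hlt⟩
  have h1 := h.anti (Nat.le_succ i)
  simp only [Nat.succ_eq_add_one] at h1
  simp only [size_topPattern, Pi.zero_apply] at hlt
  rcases le_or_gt k i with hk | hk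
  · rw [min_eq_left (by omega), min_eq_left (by omega), min_eq_left (by omega),
      min_eq_left (by omega)] at hlt
    omega
  · rw [min_eq_right (by omega), min_eq_right (by omega), min_eq_right (by omega),
      min_eq_right (by omega), size_succ (i + 1), size_succ i] at hlt
    omega

lemma addVec_topPattern (h : IsShape n l) : addVec 0 (wt n (topPattern l)) = l := by
  funext i
  simp only [addVec, extc, wt, size_topPattern]
  split_ifs with hi
  · rw [min_eq_right (by omega), min_eq_right (by omega), size_succ]
    simp
  · simp [h.zero i (by omega)]

lemma Good.eq_topPattern {p : ℕ → ℕ → ℕ} (hp : IsGT n l p) (h : Good n 0 p) :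
    p = topPattern l := by
  have h1 : ∀ i, i < n → ∀ k ≤ i, size k (p (i + 1)) = size k (p i) := by
    intro i
    induction i with
    | zero => intro _ k hk; simp [Nat.le_zero.1 hk, size]
    | succ i ih =>
      intro hi k hk
      rcases k with _ | k
      · simp [size]
      · have h2 : ¬ BadAt n 0 p k i := h k i
        simp only [BadAt, not_and, not_lt, Pi.zero_apply] at h2
        have h2 := h2 hi
        rw [ih (by omega) k (by omega)] at h2
        have h3 : size (k + 1) (p (i + 1)) ≤ size (k + 1) (p (i + 2)) :=
          size_mono fun j => (hp.strip (i + 1) j).1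
        simp only [add_assoc, Nat.reduceAdd]
        omega
  have h2 : ∀ i, ∀ k < i, p (i + 1) k = p i k := by
    intro i k hk
    by_cases hi : i < n
    · have h3 := h1 i hi (k + 1) hk
      rw [size_succ, size_succ, h1 i hi k hk.le] at h3
      omega
    · rw [hp.last i (by omega), hp.last (i + 1) (by omega)]
  have h3 : ∀ k i, k + 1 ≤ i → p i k = p (k + 1) k := by
    intro k i hi
    induction i, hi using Nat.le_induction with
    | base => rfl
    | succ i hi ih => rw [h2 i k (by omega), ih]
  funext i k
  simp only [topPattern]
  split_ifs with hk
  · rw [h3 k i hk, ← h3 k (max n (k + 1)) (le_max_right _ _), hp.last _ (le_max_left _ _)]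
  · exact hp.eq_zero i k (not_lt.1 hk)

lemma alt_zero_mul_schur (h : IsShape n l) :
    alt (shift n 0) * schur n l = alt (shift n l) := by
  rw [alt_mul_schur (d := 0) (by simp [shapes_zero]),
    sum_eq_single l]
  · have : {p ∈ patterns n l | Good n 0 p ∧ addVec 0 (wt n p) = l} = {topPattern l} := by
      ext p
      rw [mem_filter, mem_patterns, mem_singleton]
      constructor
      · rintro ⟨hp, hg, -⟩
        exact hg.eq_topPattern hp
      · rintro rfl
        exact ⟨isGT_topPattern h, good_topPattern h, addVec_topPattern h⟩
    rw [lrPat, this]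
    simp
  · intro a _ ha
    have : lrPat n l 0 a = 0 := by
      rw [lrPat, card_eq_zero, filter_eq_empty_iff]
      rintro p hp ⟨hg, rfl⟩
      rw [hg.eq_topPattern (mem_patterns.1 hp)] at ha
      exact ha (addVec_topPattern h)
    rw [this]
    simp
  · intro hl
    rw [mem_shapes] at hl
    exact absurd ⟨h, by simp⟩ hl

end

/-! ### Iterated multiplication -/

/-- Weighted number of chains of shapes `0 = l 0, …, l m` with sizes `s k`, the step `k` from
`a` to `b` having weight `W k a b`. -/
def chainCount (n : ℕ) (s : ℕ → ℕ) (W : ℕ → (ℕ → ℕ) → (ℕ → ℕ) → ℕ) : ℕ → (ℕ → ℕ) → ℕ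
  | 0, l => if l = 0 then 1 else 0
  | m + 1, l => ∑ a ∈ shapes n (s m), chainCount n s W m a * W m a l

lemma prod_mul_alt {n : ℕ} {s c : ℕ → ℕ} {W : ℕ → (ℕ → ℕ) → (ℕ → ℕ) → ℕ}
    (f : ℕ → MvPolynomial (Fin n) ℚ) (hs0 : s 0 = 0) (hs : ∀ k, s (k + 1) = s k + c k)
    (hf : ∀ k, ∀ a ∈ shapes n (s k), alt (shift n a) * f k =
      ∑ l ∈ shapes n (s k + c k), (W k a l : ℚ) • alt (shift n l)) (m : ℕ) :
    alt (shift n 0) * ∏ k ∈ range m, f k =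
      ∑ l ∈ shapes n (s m), (chainCount n s W m l : ℚ) • alt (shift n l) := by
  induction m with
  | zero => simp [hs0, shapes_zero, chainCount]
  | succ m ih =>
    rw [prod_range_succ, ← mul_assoc, ih, sum_mul]
    simp only [smul_mul_assoc]
    rw [sum_congr rfl fun a ha => by rw [hf m a ha, smul_sum], sum_comm, hs]
    refine sum_congr rfl fun l _ => ?_
    rw [chainCount]
    push_cast
    rw [sum_smul]
    exact sum_congr rfl fun a _ => smul_smul _ _ _

lemma prod_eq_sum_schur {n : ℕ} {s c : ℕ → ℕ} {W : ℕ → (ℕ → ℕ) → (ℕ → ℕ) → ℕ}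
    (f : ℕ → MvPolynomial (Fin n) ℚ) (hs0 : s 0 = 0) (hs : ∀ k, s (k + 1) = s k + c k)
    (hf : ∀ k, ∀ a ∈ shapes n (s k), alt (shift n a) * f k =
      ∑ l ∈ shapes n (s k + c k), (W k a l : ℚ) • alt (shift n l)) (m : ℕ) :
    ∏ k ∈ range m, f k =
      ∑ l ∈ shapes n (s m), (chainCount n s W m l : ℚ) • schur n l := by
  refine mul_left_cancel₀ (alt_zero_ne_zero n) ?_
  rw [prod_mul_alt f hs0 hs hf, mul_sum]
  refine sum_congr rfl fun l hl => ?_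
  rw [mul_smul_comm, alt_zero_mul_schur (mem_shapes.1 hl).1]

/-! ### Conjugation -/

lemma conjFun_le (n : ℕ) (a : ℕ → ℕ) (j : ℕ) : conjFun n a j ≤ n :=
  (card_filter_le _ _).trans (card_range n).le

lemma lt_conjFun {n : ℕ} {a : ℕ → ℕ} (h : IsShape n a) (i j : ℕ) :
    i < conjFun n a j ↔ j < a i := by
  constructor
  · intro hi
    by_contra hj
    have : {i ∈ range n | j < a i} ⊆ range i := fun k hk => by
      rw [mem_filter] at hk
      rw [mem_range]
      by_contra hki
      have := h.anti (not_lt.1 hki)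
      omega
    have := card_le_card this
    rw [card_range] at this
    exact absurd hi (not_lt.2 this)
  · intro hj
    have : range (i + 1) ⊆ {i ∈ range n | j < a i} := fun k hk => by
      rw [mem_range] at hk
      have h1 := h.anti (show k ≤ i by omega)
      rw [mem_filter, mem_range]
      refine ⟨?_, by omega⟩
      by_contra hn
      have := h.zero k (not_lt.1 hn)
      omega
    have := card_le_card this
    rwa [card_range] at this

lemma sum_conjFun {n : ℕ} {a : ℕ → ℕ} {N : ℕ} (h : ∀ i, a i ≤ N) :
    size N (conjFun n a) = size n a := by
  simp only [size, conjFun, card_filter]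
  rw [sum_comm]
  refine sum_congr rfl fun i _ => ?_
  rw [← card_filter]
  have : {j ∈ range N | j < a i} = range (a i) := by
    ext j
    have := h i
    simp only [mem_filter, mem_range]
    omega
  rw [this, card_range]

lemma conjFun_mem_shapes {n d : ℕ} {a : ℕ → ℕ} (hd : d ≤ n) (h : a ∈ shapes n d) :
    conjFun n a ∈ shapes n d := by
  rw [mem_shapes] at h ⊢
  have hle : ∀ i, a i ≤ n := fun i => (le_size h.1 i).trans (h.2.le.trans hd)
  refine ⟨⟨fun i j hij => card_le_card fun k hk => ?_, fun i hi => ?_⟩,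
    (sum_conjFun hle).trans h.2⟩
  · rw [mem_filter] at hk ⊢
    exact ⟨hk.1, hij.trans_lt hk.2⟩
  · rw [conjFun, card_eq_zero, filter_eq_empty_iff]
    intro k _ hk
    have := hle k
    omega

lemma conjFun_conjFun {n d : ℕ} {a : ℕ → ℕ} (hd : d ≤ n) (h : a ∈ shapes n d) :
    conjFun n (conjFun n a) = a := by
  funext i
  refine eq_of_forall_lt_iff fun j => ?_
  rw [lt_conjFun (mem_shapes.1 (conjFun_mem_shapes hd h)).1, lt_conjFun (mem_shapes.1 h).1]

lemma vertStrip_iff {n : ℕ} {a b : ℕ → ℕ} (ha : IsShape n a) (hb : IsShape n b) :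
    VertStrip a b ↔ HorizStrip (conjFun n a) (conjFun n b) := by
  constructor
  · intro h j
    constructor <;> refine le_of_forall_lt fun i hi => ?_ <;> rw [lt_conjFun] at hi ⊢ <;>
      first | assumption | skip
    · exact hi.trans_le (h i).1
    · have := (h i).2
      omega
  · intro h i
    constructor
    · refine le_of_forall_lt fun j hj => ?_
      rw [← lt_conjFun hb]
      rw [← lt_conjFun ha] at hj
      exact hj.trans_le (h j).1
    · by_contra hlt
      have h1 : i < conjFun n b (a i + 1) := (lt_conjFun hb _ _).2 (by omega)
      have h2 := (lt_conjFun ha _ _).1 (h1.trans_le (h (a i)).2)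
      omega

/-! ### Chains of strips -/

/-- The number of chains of horizontal strips of sizes `c 0, …, c (m - 1)` ending in `l`. -/
def hChain (n : ℕ) (c : ℕ → ℕ) : ℕ → (ℕ → ℕ) → ℕ :=
  chainCount n (fun m => size m c) fun _ a b => if HorizStrip a b then 1 else 0

/-- The number of chains of vertical strips of sizes `c 0, …, c (m - 1)` ending in `l`. -/
def vChain (n : ℕ) (c : ℕ → ℕ) : ℕ → (ℕ → ℕ) → ℕ :=
  chainCount n (fun m => size m c) fun _ a b => if VertStrip a b then 1 else 0

lemma vChain_eq {n : ℕ} {c : ℕ → ℕ} (hc : size n c ≤ n) {m : ℕ} (hm : m ≤ n) :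
    ∀ l ∈ shapes n (size m c), vChain n c m l = hChain n c m (conjFun n l) := by
  have hs : ∀ m ≤ n, size m c ≤ n := fun m hm =>
    (sum_le_sum_of_subset (range_subset_range.2 hm)).trans hc
  induction m with
  | zero =>
    intro l hl
    have h0 := hl
    rw [show size 0 c = 0 from rfl, shapes_zero, mem_singleton] at h0
    subst h0
    have h1 := conjFun_mem_shapes (hs 0 hm) hl
    rw [show size 0 c = 0 from rfl, shapes_zero, mem_singleton] at h1
    rw [h1]
    rfl
  | succ m ih =>
    intro l hl
    have hm' := hs m (by omega)
    refine sum_nbij' (conjFun n) (conjFun n) (fun a ha => conjFun_mem_shapes hm' ha)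
      (fun a ha => conjFun_mem_shapes hm' ha) (fun a ha => conjFun_conjFun hm' ha)
      (fun a ha => conjFun_conjFun hm' ha) fun a ha => ?_
    refine congrArg₂ _ (ih (by omega) a ha) (if_congr ?_ rfl rfl)
    exact vertStrip_iff (mem_shapes.1 ha).1 (mem_shapes.1 hl).1

lemma size_le_of_vChain_ne_zero {n : ℕ} {c : ℕ → ℕ} {m : ℕ} :
    ∀ l ∈ shapes n (size m c), vChain n c m l ≠ 0 →
      ∀ k, size k l ≤ ∑ j ∈ range m, min k (c j) := by
  induction m with
  | zero =>
    intro l hl _ k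
    rw [show size 0 c = 0 from rfl, shapes_zero, mem_singleton] at hl
    subst hl
    simp [size]
  | succ m ih =>
    intro l hl h k
    obtain ⟨a, ha, h1⟩ := exists_ne_zero_of_sum_ne_zero h
    have h2 := ih a ha (left_ne_zero_of_mul h1) k
    have h3 : VertStrip a l := by
      by_contra hv
      exact h1 (by simp [hv])
    rw [mem_shapes] at hl
    replace ha : IsShape n a ∧ size n a = size m c := mem_shapes.1 ha
    rw [sum_range_succ]
    have h4 : size k l ≤ size k a + k := by
      have : ∑ i ∈ range k, l i ≤ ∑ i ∈ range k, (a i + 1) := sum_le_sum fun i _ => (h3 i).2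
      simpa [sum_add_distrib, size] using this
    have h5 : size k l ≤ size k a + c m := by
      have hN : ∀ b, IsShape n b → ∀ N, n ≤ N → size N b = size n b := fun b hb N hN =>
        (sum_subset (range_subset_range.2 hN) fun i _ hi =>
          hb.zero i (by simpa using hi)).symm
      have hk : size k l + size (max k n) a ≤ size k a + size (max k n) l := by
        simp only [size]
        rw [← sum_range_add_sum_Ico _ (le_max_left k n), ← sum_range_add_sum_Ico l (le_max_left k n)]
        have : ∑ i ∈ Ico k (max k n), a i ≤ ∑ i ∈ Ico k (max k n), l i :=
          sum_le_sum fun i _ => (h3 i).1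
        omega
      rw [hN a ha.1 _ (le_max_right _ _), hN l hl.1 _ (le_max_right _ _), ha.2, hl.2,
        size_succ] at hk
      omega
    rcases le_total k (c m) with h6 | h6
    · rw [min_eq_left h6]; omega
    · rw [min_eq_right h6]; omega

lemma IsGT.truncate {m : ℕ} {l : ℕ → ℕ} {p : ℕ → ℕ → ℕ} (h : IsGT (m + 1) l p) :
    IsGT m (p m) fun i => p (min i m) := by
  refine ⟨fun k => by simp [h.zero], fun i hi => by simp [hi], fun i => ?_⟩
  rcases lt_or_ge i m with hi | hi
  · simp only [min_eq_left hi.le, min_eq_left (show i + 1 ≤ m from hi)]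
    exact h.strip i
  · simp only [min_eq_right hi, min_eq_right (show m ≤ i + 1 by omega)]
    exact fun k => ⟨le_rfl, (h.strip m (k + 1)).1.trans (h.strip m k).2⟩

lemma IsGT.extend {m : ℕ} {a l : ℕ → ℕ} {p : ℕ → ℕ → ℕ} (h : IsGT m a p) (hs : HorizStrip a l) :
    IsGT (m + 1) l fun i => if i ≤ m then p i else l := by
  refine ⟨fun k => by simp [h.zero], fun i hi => if_neg (by omega), fun i => ?_⟩
  rcases lt_trichotomy i m with hi | rfl | hi
  · rw [if_pos hi.le, if_pos (show i + 1 ≤ m from hi)]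
    exact h.strip i
  · rw [if_pos le_rfl, if_neg (by omega), h.last i le_rfl]
    exact hs
  · rw [if_neg (by omega), if_neg (by omega)]
    exact fun k => ⟨le_rfl, (hs k).2.trans (hs k).1⟩

/-- The patterns of shape `l` with weight `c`. -/
def patternsOf (n : ℕ) (c l : ℕ → ℕ) (m : ℕ) : Finset (ℕ → ℕ → ℕ) :=
  {p ∈ patterns m l | ∀ i ≤ m, size n (p i) = size i c}

lemma hChain_eq {n : ℕ} (c : ℕ → ℕ) {m : ℕ} (hm : m ≤ n) :
    ∀ l ∈ shapes n (size m c), hChain n c m l = #(patternsOf n c l m) := by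
  induction m with
  | zero =>
    intro l hl
    rw [show size 0 c = 0 from rfl, shapes_zero, mem_singleton] at hl
    subst hl
    have : patternsOf n c 0 0 = {0} := by
      ext p
      rw [patternsOf, mem_filter, mem_patterns, mem_singleton]
      constructor
      · rintro ⟨h, -⟩
        funext i
        exact h.last i (Nat.zero_le _)
      · rintro rfl
        exact ⟨⟨fun _ => rfl, fun _ _ => rfl, fun _ _ => ⟨le_rfl, le_rfl⟩⟩,
          fun i hi => by simp [Nat.le_zero.1 hi, size]⟩
    rw [this, card_singleton]
    exact if_pos rfl
  | succ m ih =>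
    intro l hl
    have hmap : ∀ p ∈ patternsOf n c l (m + 1), p m ∈ shapes n (size m c) := fun p hp => by
      rw [patternsOf, mem_filter, mem_patterns] at hp
      have h1 := hp.1.truncate.isShape
      exact mem_shapes.2 ⟨⟨h1.anti, fun i hi => h1.zero i (by omega)⟩, hp.2 m (Nat.le_succ m)⟩
    rw [card_eq_sum_card_fiberwise hmap]
    refine sum_congr rfl fun a ha => ?_
    change hChain n c m a * (if HorizStrip a l then 1 else 0) = _
    rw [ih (by omega) a ha]
    by_cases hs : HorizStrip a l
    · rw [if_pos hs, mul_one]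
      refine card_nbij' (fun p i => if i ≤ m then p i else l) (fun p i => p (min i m)) ?_ ?_ ?_ ?_
      · intro p hp
        simp only [patternsOf, coe_filter, mem_filter, mem_patterns, Set.mem_ofPred_eq] at hp ⊢
        refine ⟨⟨hp.1.extend hs, fun i hi => ?_⟩, ?_⟩
        · split_ifs with h1
          · exact hp.2 i h1
          · rw [show i = m + 1 by omega]
            exact (mem_shapes.1 hl).2
        · rw [if_pos le_rfl, hp.1.last m le_rfl]
      · intro p hp
        simp only [patternsOf, coe_filter, mem_filter, mem_patterns, Set.mem_ofPred_eq] at hp ⊢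
        obtain ⟨⟨h1, h2⟩, rfl⟩ := hp
        exact ⟨h1.truncate, fun i hi => by rw [min_eq_left hi]; exact h2 i (by omega)⟩
      · intro p hp
        simp only [patternsOf, coe_filter, mem_patterns, Set.mem_ofPred_eq] at hp
        funext i
        beta_reduce
        rw [if_pos (min_le_right _ _)]
        rcases le_total i m with h1 | h1
        · rw [min_eq_left h1]
        · rw [min_eq_right h1, hp.1.last m le_rfl, hp.1.last i h1]
      · intro p hp
        simp only [patternsOf, coe_filter, mem_filter, mem_patterns, Set.mem_ofPred_eq] at hp
        funext i
        beta_reduce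
        split_ifs with h1
        · rw [min_eq_left h1]
        · rw [hp.1.1.last i (by omega)]
    · rw [if_neg hs, mul_zero, eq_comm, card_eq_zero, filter_eq_empty_iff]
      rintro p hp rfl
      rw [patternsOf, mem_filter, mem_patterns] at hp
      exact hs (hp.1.last (m + 1) le_rfl ▸ hp.1.strip m)

lemma cf_schur (n : ℕ) (c l : ℕ → ℕ) :
    cf (fun i => c i) (schur n l) = #(patternsOf n c l n) := by
  simp only [schur, map_sum, cf_mono, patternsOf]
  rw [sum_boole]
  congr 2
  ext p
  simp only [mem_filter, mem_patterns, and_congr_right_iff]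
  intro hp
  constructor
  · intro h i
    induction i with
    | zero => intro _; exact hp.size_zero n
    | succ i ih =>
      intro hi
      have h1 := congrFun h ⟨i, hi⟩
      have h2 := hp.size_mono (Nat.le_succ i)
      simp only [wt, Nat.succ_eq_add_one] at h1 h2
      rw [size_succ, ← ih (by omega), ← h1]
      omega
  · intro h
    funext i
    rw [wt, h _ i.2, h _ i.2.le, size_succ, Nat.add_sub_cancel_left]

/-! ### Cauchy identities -/

lemma prod_hpoly (n : ℕ) (c : ℕ → ℕ) :
    ∏ k ∈ range n, hpoly n (c k) =
      ∑ l ∈ shapes n (size n c), cf (fun i => c i) (schur n l) • schur n l := by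
  rw [prod_eq_sum_schur (s := fun m => size m c) (fun k => hpoly n (c k)) rfl
    (fun k => size_succ k c) (fun _ _ ha => alt_mul_hpoly ha)]
  refine sum_congr rfl fun l hl => ?_
  rw [cf_schur, ← hChain_eq c le_rfl l hl]
  rfl

lemma prod_esum_eq (n : ℕ) (c : ℕ → ℕ) :
    ∏ k ∈ range n, esum (var (n := n)) (c k) =
      ∑ l ∈ shapes n (size n c), (vChain n c n l : ℚ) • schur n l :=
  prod_eq_sum_schur (s := fun m => size m c) (fun k => esum var (c k)) rfl
    (fun k => size_succ k c) (fun _ _ ha => alt_mul_esum ha) n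

lemma vChain_eq_cf {n : ℕ} {c : ℕ → ℕ} (hc : size n c ≤ n) {l : ℕ → ℕ}
    (hl : l ∈ shapes n (size n c)) :
    (vChain n c n l : ℚ) = cf (fun i => c i) (schur n (conjFun n l)) := by
  rw [cf_schur, ← hChain_eq c le_rfl _ (conjFun_mem_shapes hc hl), vChain_eq hc le_rfl l hl]

lemma prod_esum {n : ℕ} {c : ℕ → ℕ} (hc : size n c ≤ n) :
    ∏ k ∈ range n, esum (var (n := n)) (c k) =
      ∑ l ∈ shapes n (size n c), cf (fun i => c i) (schur n (conjFun n l)) • schur n l := by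
  rw [prod_esum_eq]
  exact sum_congr rfl fun l hl => by rw [vChain_eq_cf hc hl]

/-! ### Sums over colorings fixed by a permutation -/

lemma prod_esum_families {X R : Type*} [Fintype X] [CommSemiring R] {m : ℕ} (w : X → R)
    (c : Fin m → ℕ) :
    ∏ k, esum w (c k) =
      ∑ S : Finset (X × Fin m) with ∀ k, #{s ∈ S | s.2 = k} = c k, ∏ s ∈ S, w s.1 := by
  simp only [esum, prod_univ_sum]
  have hcard : ∀ (S : Finset (X × Fin m)) k,
      #{s ∈ S | s.2 = k} = #{x | (x, k) ∈ S} := fun S k => by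
    refine card_nbij' Prod.fst (fun x => (x, k)) ?_ ?_ ?_ ?_
    · rintro ⟨x, k'⟩ h
      simp only [coe_filter, Set.mem_ofPred_eq, mem_univ, true_and] at h ⊢
      rw [← h.2]; exact h.1
    · intro x h
      simpa using h
    · rintro ⟨x, k'⟩ h
      simp only [coe_filter, Set.mem_ofPred_eq] at h
      simp [h.2]
    · intro x _
      rfl
  refine sum_nbij' (fun p => ({s | s.1 ∈ p s.2} : Finset (X × Fin m)))
    (fun S k => ({x | (x, k) ∈ S} : Finset X)) ?_ ?_ ?_ ?_ ?_
  · intro p hp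
    simp only [Fintype.mem_piFinset, mem_powersetCard, subset_univ, true_and] at hp
    simp only [mem_filter, mem_univ, true_and, hcard]
    intro k
    rw [← hp k]
    congr 1
    ext x
    simp
  · intro S hS
    simp only [mem_filter, mem_univ, true_and, hcard] at hS
    simpa [Fintype.mem_piFinset, mem_powersetCard] using hS
  · intro p _
    funext k
    ext x
    simp
  · intro S _
    ext ⟨x, k⟩
    simp
  · intro p _
    exact (prod_finset_product_right ({s | s.1 ∈ p s.2} : Finset (X × Fin m)) univ p
      (f := fun s => w s.1) fun s => by simp).symm

/-- The sum of the weights of the colorings fixed by `g`. -/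
def fixSum {n : ℕ} {X R : Type*} [Fintype X] [CommSemiring R] (w : X → R) (g : Perm (Fin n)) : R :=
  ∑ f : Fin n → X with f ∘ g = f, ∏ x, w (f x)

/-- The numbers of points of each color. -/
def cnt {n : ℕ} {Y : Type*} (F : Fin n → Y) (y : Y) : ℕ := #{x | F x = y}

lemma cnt_def {n : ℕ} {Y : Type*} [DecidableEq Y] (F : Fin n → Y) (y : Y) :
    cnt F y = #{x | F x = y} := by
  rw [cnt]
  congr!

lemma sum_cnt {n : ℕ} {Y : Type*} [Fintype Y] (F : Fin n → Y) : ∑ y, cnt F y = n := by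
  have := card_eq_sum_card_fiberwise (s := univ) (t := univ) (f := F) (by simp)
  rw [card_univ, Fintype.card_fin] at this
  exact this.symm

lemma cf_fixSum {n : ℕ} (c : Fin n → ℕ) (g : Perm (Fin n)) :
    cf c (fixSum var g) = #{h : Fin n → Fin n | h ∘ g = h ∧ cnt h = c} := by
  simp only [fixSum, map_sum, prod_var, cf_mono]
  rw [sum_boole, filter_filter]
  congr! 6
  rw [cnt]
  congr!

lemma cf_smul_fixSum {n : ℕ} {X R : Type*} [Fintype X] [CommRing R] [Algebra ℚ R] (w : X → R)
    (c : Fin n → ℕ) (g : Perm (Fin n)) :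
    cf c (fixSum var g) • fixSum w g =
      ∑ F : Fin n → X × Fin n with F ∘ g = F ∧ cnt (fun x => (F x).2) = c,
        ∏ x, w (F x).1 := by
  rw [cf_fixSum, Nat.cast_smul_eq_nsmul, ← sum_const, fixSum, ← sum_product']
  refine sum_nbij' (fun p x => (p.2 x, p.1 x)) (fun F => (fun x => (F x).2, fun x => (F x).1))
    ?_ ?_ (fun _ _ => rfl) (fun _ _ => rfl) (fun _ _ => rfl)
  · rintro ⟨h, f⟩ hp
    simp only [mem_product, mem_filter, mem_univ, true_and] at hp ⊢
    refine ⟨?_, hp.1.2⟩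
    funext x
    exact Prod.ext (congrFun hp.2 x) (congrFun hp.1.1 x)
  · intro F hF
    simp only [mem_product, mem_filter, mem_univ, true_and] at hF ⊢
    exact ⟨⟨funext fun x => congrArg Prod.snd (congrFun hF.1 x), hF.2⟩,
      funext fun x => congrArg Prod.fst (congrFun hF.1 x)⟩

lemma sum_sign_fix {n : ℕ} {Y : Type*} (F : Fin n → Y) :
    ∑ g ∈ univ.filter (fun g : Perm (Fin n) => F ∘ g = F), ((Perm.sign g : ℤ) : ℚ) =
      if Function.Injective F then 1 else 0 := by
  split_ifs with h
  · have : univ.filter (fun g : Perm (Fin n) => F ∘ g = F) = {1} := by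
      ext g
      simp only [mem_filter, mem_univ, true_and, mem_singleton]
      constructor
      · intro hg
        ext x
        rw [h (congrFun hg x)]
        rfl
      · rintro rfl
        rfl
    rw [this]
    simp
  · simp only [Function.Injective, not_forall] at h
    obtain ⟨i, j, hF, hij⟩ := h
    have hs : F ∘ swap i j = F := by
      funext x
      simp only [Function.comp, swap_apply_def]
      split_ifs with h1 h2
      · rw [h1, hF]
      · rw [h2, hF]
      · rfl
    refine sum_involution (fun g _ => swap i j * g) ?_ ?_ ?_ ?_
    · intro g _
      simp [Perm.sign_mul, Perm.sign_swap hij]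
    · intro g _ _ heq
      exact hij (swap_eq_one_iff.1 (mul_eq_right.1 heq))
    · intro g hg
      simp only [mem_filter, mem_univ, true_and] at hg ⊢
      rw [Perm.coe_mul, ← Function.comp_assoc, hs, hg]
    · intro g _
      simp [← mul_assoc]

lemma sum_injective {n : ℕ} {Y M : Type*} [Fintype Y] [AddCommMonoid M] (φ : Finset Y → M) :
    ∑ F : Fin n → Y with Function.Injective F, φ (univ.image F) =
      n.factorial • ∑ S ∈ powersetCard n univ, φ S := by
  have hmap : ∀ F ∈ ({F | Function.Injective F} : Finset (Fin n → Y)),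
      univ.image F ∈ powersetCard n univ := fun F hF => by
    rw [mem_powersetCard, card_image_of_injective _ (mem_filter.1 hF).2]
    simp
  rw [← sum_fiberwise_of_maps_to hmap, smul_sum]
  refine sum_congr rfl fun S hS => ?_
  rw [sum_congr rfl (g := fun _ => φ S) (fun t ht => by rw [(mem_filter.1 ht).2]), sum_const]
  congr 1
  rw [mem_powersetCard] at hS
  have h1 : Fintype.card (Fin n) = Fintype.card S := by simp [hS.2]
  rw [filter_filter]
  let e := Fintype.equivOfCardEq h1
  have h2 : #(univ : Finset (Perm (Fin n))) = n.factorial := by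
    rw [card_univ, Fintype.card_perm, Fintype.card_fin]
  rw [← h2]
  symm
  refine card_bij (fun σ _ x => (e (σ x) : Y)) ?_ ?_ ?_
  · intro σ _
    simp only [mem_filter, mem_univ, true_and]
    refine ⟨Subtype.val_injective.comp (e.injective.comp σ.injective), ?_⟩
    ext y
    simp only [mem_image, mem_univ, true_and]
    constructor
    · rintro ⟨x, rfl⟩
      exact (e (σ x)).2
    · intro hy
      exact ⟨σ.symm (e.symm ⟨y, hy⟩), by simp⟩
  · intro σ _ τ _ h
    ext x
    rw [e.injective (Subtype.ext (congrFun h x))]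
  · intro F hF
    simp only [mem_filter, mem_univ, true_and] at hF
    have hmem : ∀ x, F x ∈ S := fun x => hF.2 ▸ mem_image_of_mem F (mem_univ x)
    refine ⟨Equiv.ofBijective (fun x => e.symm ⟨F x, hmem x⟩) ?_, mem_univ _, ?_⟩
    · refine Finite.injective_iff_bijective.1 fun x y h => hF.1 ?_
      simpa using h
    · funext x
      simp

lemma sum_sign_cf_fixSum {n : ℕ} {X R : Type*} [Fintype X] [CommRing R] [Algebra ℚ R] (w : X → R)
    (c : Fin n → ℕ) (hc : ∑ k, c k = n) :
    ∑ g : Perm (Fin n), ((Perm.sign g : ℤ) : ℚ) • cf c (fixSum var g) • fixSum w g =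
      n.factorial • ∏ k, esum w (c k) := by
  have h1 : ∀ S : Finset (X × Fin n), (∀ k, #{s ∈ S | s.2 = k} = c k) → #S = n := fun S hS => by
    rw [card_eq_sum_card_fiberwise (t := univ) (f := Prod.snd) (by simp)]
    exact (sum_congr rfl fun k _ => hS k).trans hc
  let φ : Finset (X × Fin n) → R := fun S =>
    if ∀ k, #{s ∈ S | s.2 = k} = c k then ∏ s ∈ S, w s.1 else 0
  have h2 : ∑ S, φ S = ∑ S ∈ powersetCard n univ, φ S := by
    symm
    refine sum_subset (subset_univ _) fun S _ hS => if_neg fun h => hS ?_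
    rw [mem_powersetCard]
    exact ⟨subset_univ _, h1 S h⟩
  rw [prod_esum_families, sum_filter]
  change _ = _ • ∑ S, φ S
  rw [h2, ← sum_injective]
  simp only [cf_smul_fixSum, sum_filter, smul_sum]
  rw [sum_comm]
  refine sum_congr rfl fun F _ => ?_
  have h3 := sum_sign_fix F
  have h4 : ∀ hF : Function.Injective F, φ (univ.image F) =
      if cnt (fun x => (F x).2) = c then ∏ x, w (F x).1 else 0 := fun hF => by
    simp only [φ, prod_image hF.injOn, filter_image, card_image_of_injective _ hF]
    refine if_congr ?_ rfl rfl
    simp only [funext_iff, cnt_def]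
  by_cases hC : cnt (fun x => (F x).2) = c
  · simp only [hC, and_true, if_true, smul_ite, smul_zero] at h4 ⊢
    rw [← sum_filter, ← sum_smul]
    trans (if Function.Injective F then (1 : ℚ) else 0) • ∏ x, w (F x).1
    · congr 1
      convert h3
    · split_ifs with hF
      · rw [one_smul]
        convert (h4 hF).symm
      · rw [zero_smul]
  · simp only [hC, and_false, if_false, smul_zero, sum_const_zero] at h4 ⊢
    split_ifs with hF
    · convert (h4 hF).symm
    · rfl

/-! ### Burnside counting -/

lemma exists_perm_of_cnt {n : ℕ} {Y : Type*} {F G : Fin n → Y} (h : cnt F = cnt G) :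
    ∃ g : Perm (Fin n), F ∘ g = G := by
  have h1 : ∀ y, Nonempty ({x // G x = y} ≃ {x // F x = y}) := fun y => by
    refine ⟨Fintype.equivOfCardEq ?_⟩
    rw [Fintype.card_subtype, Fintype.card_subtype]
    exact (congrFun h y).symm
  let e : Fin n ≃ Fin n := (sigmaFiberEquiv G).symm.trans
    ((sigmaCongrRight fun y => (h1 y).some).trans (sigmaFiberEquiv F))
  refine ⟨e, funext fun x => ?_⟩
  exact ((h1 (G x)).some ⟨x, rfl⟩).2

lemma exists_cnt {n : ℕ} {Y : Type*} [Fintype Y] (M : Y → ℕ) (h : ∑ y, M y = n) :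
    ∃ F : Fin n → Y, cnt F = M := by
  have h1 : Fintype.card (Fin n) = Fintype.card (Σ y, Fin (M y)) := by simp [h]
  let e := Fintype.equivOfCardEq h1
  refine ⟨fun x => (e x).1, ?_⟩
  funext y
  have : #{x | (e x).1 = y} = #(univ : Finset (Fin (M y))) := by
    symm
    refine card_bij (fun i _ => e.symm ⟨y, i⟩) (by simp) (by simp) ?_
    intro x hx
    simp only [mem_filter, mem_univ, true_and] at hx
    subst hx
    exact ⟨(e x).2, mem_univ _, by simp⟩
  rw [cnt, this]
  simp

lemma sum_card_fix {n : ℕ} {Y M : Type*} [Fintype Y] [AddCommMonoid M] (φ : (Y → ℕ) → M) :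
    ∑ g : Perm (Fin n), ∑ F : Fin n → Y with F ∘ g = F, φ (cnt F) =
      n.factorial • ∑ v ∈ piAntidiag univ n, φ v := by
  have hcomp : ∀ (F : Fin n → Y) (g : Perm (Fin n)), cnt (F ∘ g) = cnt F := fun F g => by
    funext y
    exact card_bij' (fun x _ => g x) (fun x _ => g.symm x) (by simp) (by simp) (by simp) (by simp)
  simp only [sum_filter]
  rw [sum_comm]
  simp only [← sum_filter, sum_const]
  have hmap : ∀ F ∈ (univ : Finset (Fin n → Y)), cnt F ∈ piAntidiag univ n := fun F _ => by
    simp [mem_piAntidiag, sum_cnt]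
  rw [← sum_fiberwise_of_maps_to hmap, smul_sum]
  refine sum_congr rfl fun v hv => ?_
  rw [mem_piAntidiag] at hv
  obtain ⟨F₀, rfl⟩ := exists_cnt v hv.1
  have h1 : ∀ F ∈ ({F | cnt F = cnt F₀} : Finset (Fin n → Y)),
      #(univ.filter (fun g : Perm (Fin n) => F ∘ g = F)) • φ (cnt F) =
      #(univ.filter (fun g : Perm (Fin n) => F₀ ∘ g = F)) • φ (cnt F₀) := fun F hF => by
    rw [(mem_filter.1 hF).2]
    congr 1
    obtain ⟨g₀, hg₀⟩ := exists_perm_of_cnt (mem_filter.1 hF).2.symm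
    refine card_bij' (fun g _ => g₀ * g) (fun g _ => g₀⁻¹ * g) ?_ ?_ (by simp) (by simp)
    · intro g hg
      simp only [mem_filter, mem_univ, true_and] at hg ⊢
      rw [Perm.coe_mul, ← Function.comp_assoc, hg₀, hg]
    · intro g hg
      simp only [mem_filter, mem_univ, true_and] at hg ⊢
      rw [← hg₀, Function.comp_assoc, ← Perm.coe_mul, mul_inv_cancel_left, hg, hg₀]
  rw [sum_congr rfl h1, ← sum_smul]
  congr 1
  rw [← card_eq_sum_card_fiberwise (f := fun g : Perm (Fin n) => F₀ ∘ g), card_univ,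
    Fintype.card_perm, Fintype.card_fin]
  intro g _
  simp [hcomp]

lemma cnt_fst {n : ℕ} {X Z : Type*} [Fintype X] [Fintype Z] (F : Fin n → X × Z) (x : X) :
    cnt (fun i => (F i).1) x = ∑ z, cnt F (x, z) := by
  simp only [cnt, card_filter]
  rw [sum_comm]
  refine sum_congr rfl fun i _ => ?_
  split_ifs with h <;> simp [Prod.ext_iff, h]

lemma cnt_snd {n : ℕ} {X Z : Type*} [Fintype X] [Fintype Z] (F : Fin n → X × Z) (z : Z) :
    cnt (fun i => (F i).2) z = ∑ x, cnt F (x, z) := by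
  simp only [cnt, card_filter]
  rw [sum_comm]
  refine sum_congr rfl fun i _ => ?_
  split_ifs with h <;> simp [Prod.ext_iff, h]

lemma prod_hpoly_univ {n : ℕ} (c : Fin n → ℕ) :
    ∏ k, hpoly n (c k) =
      ∑ v ∈ piAntidiag (univ : Finset (Fin n × Fin n)) (∑ k, c k),
        if (fun k => ∑ i, v (i, k)) = c then mono (fun i => ∑ k, v (i, k)) else 0 := by
  simp only [hpoly, prod_univ_sum, prod_mono]
  rw [← sum_filter]
  refine sum_nbij' (fun p s => p s.2 s.1) (fun v k i => v (i, k)) ?_ ?_ (fun _ _ => rfl)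
    (fun _ _ => rfl) ?_
  · intro p hp
    simp only [Fintype.mem_piFinset, mem_piAntidiag] at hp
    simp only [mem_filter, mem_piAntidiag, mem_univ, implies_true, and_true]
    refine ⟨?_, funext fun k => (hp k).1⟩
    rw [Fintype.sum_prod_type_right]
    exact sum_congr rfl fun k _ => (hp k).1
  · intro v hv
    simp only [mem_filter, mem_piAntidiag] at hv
    simp only [Fintype.mem_piFinset, mem_piAntidiag, mem_univ, implies_true, and_true]
    exact fun k => congrFun hv.2 k
  · intro p _
    congr 1
    funext i
    simp

lemma sum_cf_fixSum_of_eq {n : ℕ} {c : Fin n → ℕ} (hc : ∑ k, c k = n) :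
    ∑ g : Perm (Fin n), cf c (fixSum var g) • fixSum (var (n := n)) g =
      n.factorial • ∏ k, hpoly n (c k) := by
  rw [prod_hpoly_univ, hc]
  refine Eq.trans ?_ ((sum_card_fix (n := n) fun v : Fin n × Fin n → ℕ =>
    if (fun k => ∑ i, v (i, k)) = c then mono (fun i => ∑ k, v (i, k)) else 0).trans
      (by congr!))
  refine sum_congr rfl fun g _ => ?_
  rw [cf_smul_fixSum, ← filter_filter, sum_filter (p := fun F => _ = c)]
  refine sum_congr (by congr!) fun F _ => ?_
  refine if_congr ?_ ?_ rfl
  · simp only [funext_iff, cnt_snd]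
  · rw [prod_var]
    congr 1
    funext i
    rw [← cnt_fst, cnt_def]

lemma cf_fixSum_of_ne {n : ℕ} {c : Fin n → ℕ} (hc : ∑ k, c k ≠ n) (g : Perm (Fin n)) :
    cf c (fixSum var g) = 0 := by
  rw [cf_fixSum, Nat.cast_eq_zero, card_eq_zero, filter_eq_empty_iff]
  rintro h - ⟨-, rfl⟩
  exact hc (sum_cnt h)

lemma cf_schur_of_ne {n : ℕ} {c : Fin n → ℕ} {l : ℕ → ℕ} (hc : ∑ k, c k ≠ size n l) :
    cf c (schur n l) = 0 := by
  simp only [schur, map_sum, cf_mono]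
  refine sum_eq_zero fun p hp => if_neg ?_
  rintro rfl
  exact hc (sum_wt (mem_patterns.1 hp))

lemma sum_eq_size {n : ℕ} (c : Fin n → ℕ) : ∑ k, c k = size n (extc c) := by
  rw [size, sum_range]
  exact sum_congr rfl fun k _ => by simp [extc]

lemma cf_extc {n : ℕ} (c : Fin n → ℕ) : cf (fun i : Fin n => extc c i) = cf c := by
  congr 1
  funext i
  simp [extc]

/-- The orthogonality relation of the power sums, in reproducing kernel form. -/
lemma sum_cf_fixSum {n : ℕ} (c : Fin n → ℕ) :
    ∑ g : Perm (Fin n), cf c (fixSum var g) • fixSum (var (n := n)) g =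
      n.factorial • ∑ l ∈ shapes n n, cf c (schur n l) • schur n l := by
  by_cases hc : ∑ k, c k = n
  · rw [sum_cf_fixSum_of_eq hc]
    have := prod_hpoly n (extc c)
    rw [← sum_eq_size, hc, cf_extc, prod_range] at this
    rw [← this]
    congr 1
    exact prod_congr rfl fun k _ => by simp [extc]
  · rw [sum_eq_zero fun g _ => by rw [cf_fixSum_of_ne hc, zero_smul], sum_eq_zero, smul_zero]
    intro l hl
    rw [cf_schur_of_ne (by rwa [(mem_shapes.1 hl).2]), zero_smul]

/-- The signed version of the orthogonality relation of the power sums. -/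
lemma sum_sign_cf_fixSum_var {n : ℕ} (c : Fin n → ℕ) :
    ∑ g : Perm (Fin n), ((Perm.sign g : ℤ) : ℚ) • cf c (fixSum var g) • fixSum (var (n := n)) g =
      n.factorial • ∑ l ∈ shapes n n, cf c (schur n (conjFun n l)) • schur n l := by
  by_cases hc : ∑ k, c k = n
  · rw [sum_sign_cf_fixSum _ _ hc]
    have h1 : size n (extc c) = n := by rw [← sum_eq_size, hc]
    have := prod_esum h1.le
    rw [h1, cf_extc, prod_range] at this
    rw [← this]
    congr 1
    exact prod_congr rfl fun k _ => by simp [extc]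
  · rw [sum_eq_zero fun g _ => by rw [cf_fixSum_of_ne hc, zero_smul, smul_zero], sum_eq_zero,
      smul_zero]
    intro l hl
    have := (mem_shapes.1 (conjFun_mem_shapes le_rfl hl)).2
    rw [cf_schur_of_ne (by rwa [this]), zero_smul]

/-! ### Characters -/

/-- The coefficient extraction dual to the Schur polynomial of shape `a`. -/
def schurCoeff (n : ℕ) (a : ℕ → ℕ) : MvPolynomial (Fin n) ℚ →ₗ[ℚ] ℚ :=
  (cf (shift n a)).comp (LinearMap.mulLeft ℚ (alt (shift n 0)))

lemma schurCoeff_apply {n : ℕ} (a : ℕ → ℕ) (f : MvPolynomial (Fin n) ℚ) :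
    schurCoeff n a f = cf (shift n a) (alt (shift n 0) * f) := rfl

lemma schurCoeff_schur {n : ℕ} {a l : ℕ → ℕ} (ha : IsShape n a) (hl : IsShape n l) :
    schurCoeff n a (schur n l) = if l = a then 1 else 0 := by
  rw [schurCoeff_apply, alt_zero_mul_schur hl, cf_alt ha hl]

lemma permChar_eq {n : ℕ} {c : ℕ → ℕ} (hc : ∀ k, n ≤ k → c k = 0) (g : Perm (Fin n)) :
    permChar n c g = cf (fun i : Fin n => c i) (fixSum var g) := by
  rw [cf_fixSum, permChar, ← Fintype.card_subtype, ← Nat.card_eq_fintype_card]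
  congr 1
  symm
  have hcard : ∀ (f : Fin n → ℕ) k, Nat.card {x : Fin n // f x = k} = cnt f k := fun f k => by
    rw [Nat.card_eq_fintype_card, Fintype.card_subtype, cnt_def]
  have hlt : ∀ f : Fin n → ℕ, (∀ k, cnt f k = c k) → ∀ x, f x < n := fun f hf x => by
    by_contra h
    have h1 := hf (f x)
    rw [hc _ (not_lt.1 h), cnt_def, card_eq_zero, filter_eq_empty_iff] at h1
    exact h1 (mem_univ x) rfl
  have hval : ∀ (h : Fin n → Fin n) (k : Fin n), cnt (fun x => (h x : ℕ)) k = cnt h k :=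
    fun h k => by simp only [cnt, Fin.ext_iff]
  simp only [hcard]
  refine Nat.card_congr ⟨fun h => ⟨fun x => h.1 x, fun k => ?_, fun x => ?_⟩,
    fun f => ⟨fun x => ⟨f.1 x, hlt f.1 f.2.1 x⟩, ?_, ?_⟩, fun _ => rfl, fun _ => rfl⟩
  · by_cases hk : k < n
    · exact (hval h.1 ⟨k, hk⟩).trans (congrFun h.2.2 ⟨k, hk⟩)
    · rw [hc k (not_lt.1 hk), cnt_def, card_eq_zero, filter_eq_empty_iff]
      intro x _ hx
      exact hk (hx ▸ (h.1 x).2)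
  · exact congrArg Fin.val (congrFun h.2.1 x)
  · exact funext fun x => Fin.ext (f.2.2 x)
  · exact funext fun k => (hval _ k).symm.trans (f.2.1 k)

lemma irrChar_eq (n : ℕ) (a : ℕ → ℕ) (g : Perm (Fin n)) :
    irrChar n a g = schurCoeff n a (fixSum var g) := by
  simp only [irrChar, schurCoeff_apply, alt, sum_mul, map_sum, smul_mul_assoc, map_smul,
    smul_eq_mul, cf_mul_mono]
  refine sum_congr rfl fun σ _ => ?_
  congr 1
  rw [permCharZ]
  have hiff : (∀ k, 0 ≤ (if h : k < n then (a k : ℤ) - k + ((σ ⟨k, h⟩ : Fin n) : ℕ) else 0)) ↔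
      ∀ i, (shift n 0 ∘ σ) i ≤ shift n a i := by
    simp only [shift, Function.comp, Pi.zero_apply, zero_add]
    constructor
    · intro h i
      have h1 := h i
      rw [dif_pos i.2] at h1
      simp only [Fin.eta] at h1
      have := i.2
      have := (σ i).2
      omega
    · intro h k
      split_ifs with hk
      · have h1 := h ⟨k, hk⟩
        simp only at h1
        have := (σ ⟨k, hk⟩).2
        omega
      · exact le_rfl
  by_cases h : ∀ i, (shift n 0 ∘ σ) i ≤ shift n a i
  · rw [if_pos (hiff.2 h), if_pos h, permChar_eq]
    · congr 2
      funext i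
      have h1 := h i
      simp only [shift, Function.comp, Pi.zero_apply, zero_add, dif_pos i.2, Fin.eta] at h1 ⊢
      have := i.2
      have := (σ i).2
      omega
    · intro k hk
      simp [not_lt.2 hk]
  · rw [if_neg (mt hiff.1 h), if_neg h]

lemma sum_mul_of_kernel {n : ℕ} {ι κ : Type*} {s : Finset ι} {t : Finset κ} {u : ι → ℚ}
    {P : ι → MvPolynomial (Fin n) ℚ} {r : ℕ} {A B : κ → MvPolynomial (Fin n) ℚ}
    (h : ∀ c, ∑ i ∈ s, u i • cf c (P i) • P i = r • ∑ k ∈ t, cf c (A k) • B k)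
    (φ ψ : MvPolynomial (Fin n) ℚ →ₗ[ℚ] ℚ) :
    ∑ i ∈ s, u i * (φ (P i) * ψ (P i)) = r * ∑ k ∈ t, φ (A k) * ψ (B k) := by
  have h1 : ∑ i ∈ s, (u i * ψ (P i)) • P i = (r : ℚ) • ∑ k ∈ t, ψ (B k) • A k := by
    refine cf_ext fun c => ?_
    have := congrArg ψ (h c)
    rw [← Nat.cast_smul_eq_nsmul ℚ] at this
    simp only [map_sum, map_smul, smul_eq_mul] at this ⊢
    rw [sum_congr rfl fun k _ => mul_comm (ψ (B k)) (cf c (A k)), ← this]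
    exact sum_congr rfl fun i _ => by ring
  have := congrArg φ h1
  simp only [map_sum, map_smul, smul_eq_mul] at this
  rw [sum_congr rfl fun k _ => mul_comm (φ (A k)) (ψ (B k)), ← this]
  exact sum_congr rfl fun i _ => by ring

lemma sum_fixSum_mul {n : ℕ} (φ ψ : MvPolynomial (Fin n) ℚ →ₗ[ℚ] ℚ) :
    ∑ g : Perm (Fin n), φ (fixSum var g) * ψ (fixSum var g) =
      n.factorial * ∑ l ∈ shapes n n, φ (schur n l) * ψ (schur n l) := by
  rw [← sum_mul_of_kernel (s := univ) (u := fun _ => 1) (P := fixSum (n := n) var)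
    fun c => by simp only [one_smul]; exact sum_cf_fixSum c]
  simp only [one_mul]

lemma sum_sign_fixSum_mul {n : ℕ} (φ ψ : MvPolynomial (Fin n) ℚ →ₗ[ℚ] ℚ) :
    ∑ g : Perm (Fin n), ((Perm.sign g : ℤ) : ℚ) * (φ (fixSum var g) * ψ (fixSum var g)) =
      n.factorial * ∑ l ∈ shapes n n, φ (schur n (conjFun n l)) * ψ (schur n l) :=
  sum_mul_of_kernel (fun c => sum_sign_cf_fixSum_var c) φ ψ

lemma sum_irrChar_mul {n : ℕ} {a b : ℕ → ℕ} (ha : a ∈ shapes n n) (hb : b ∈ shapes n n) :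
    ∑ g, irrChar n a g * irrChar n b g = if a = b then (n.factorial : ℚ) else 0 := by
  simp only [irrChar_eq]
  rw [sum_fixSum_mul, sum_eq_single a]
  · rw [schurCoeff_schur (mem_shapes.1 ha).1 (mem_shapes.1 ha).1,
      schurCoeff_schur (mem_shapes.1 hb).1 (mem_shapes.1 ha).1]
    simp
  · intro l hl hla
    rw [schurCoeff_schur (mem_shapes.1 ha).1 (mem_shapes.1 hl).1, if_neg hla, zero_mul]
  · exact fun h => absurd ha h

/-- The sign twist of a permutation character decomposes with Kostka numbers. -/
lemma sign_mul_permChar {n : ℕ} {c : ℕ → ℕ} (hc : ∀ k, n ≤ k → c k = 0) (g : Perm (Fin n)) :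
    ((Perm.sign g : ℤ) : ℚ) * permChar n c g =
      ∑ a ∈ shapes n n, cf (fun i => c i) (schur n (conjFun n a)) * irrChar n a g := by
  let K : (ℕ → ℕ) → ℚ := fun a => cf (fun i => c i) (schur n (conjFun n a))
  let S : Perm (Fin n) → ℚ := fun g => ((Perm.sign g : ℤ) : ℚ) * permChar n c g
  let T : Perm (Fin n) → ℚ := fun g => ∑ a ∈ shapes n n, K a * irrChar n a g
  have hSS : ∑ g, S g * S g = n.factorial * ∑ a ∈ shapes n n, K a * K a := by
    have h1 : ∀ g, S g * S g =
        cf (fun i => c i) (fixSum var g) * cf (fun i => c i) (fixSum var g) := fun g => by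
      rw [← permChar_eq hc]
      simp only [S]
      rcases Int.units_eq_one_or (Perm.sign g) with h | h <;> simp [h]
    rw [sum_congr rfl fun g _ => h1 g, sum_fixSum_mul]
    congr 1
    refine sum_bij' (fun a _ => conjFun n a) (fun a _ => conjFun n a)
      (fun a ha => conjFun_mem_shapes le_rfl ha) (fun a ha => conjFun_mem_shapes le_rfl ha)
      (fun a ha => conjFun_conjFun le_rfl ha) (fun a ha => conjFun_conjFun le_rfl ha)
      fun a ha => ?_
    simp only [K, conjFun_conjFun le_rfl ha]
  have hS : ∀ a ∈ shapes n n, ∑ g, S g * irrChar n a g = n.factorial * K a := fun a ha => by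
    simp only [S, irrChar_eq, permChar_eq hc, mul_assoc]
    rw [sum_sign_fixSum_mul, sum_eq_single a]
    · rw [schurCoeff_schur (mem_shapes.1 ha).1 (mem_shapes.1 ha).1, if_pos rfl, mul_one]
    · intro l hl hla
      rw [schurCoeff_schur (mem_shapes.1 ha).1 (mem_shapes.1 hl).1, if_neg hla, mul_zero]
    · exact fun h => absurd ha h
  have hST : ∑ g, S g * T g = n.factorial * ∑ a ∈ shapes n n, K a * K a := by
    simp only [T, mul_sum]
    rw [sum_comm]
    refine sum_congr rfl fun a ha => ?_
    rw [mul_left_comm, ← hS a ha, mul_sum]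
    exact sum_congr rfl fun g _ => by ring
  have hTT : ∑ g, T g * T g = n.factorial * ∑ a ∈ shapes n n, K a * K a := by
    simp only [T, sum_mul_sum]
    rw [sum_comm, mul_sum]
    refine sum_congr rfl fun a ha => ?_
    rw [sum_comm, sum_eq_single a]
    · have := sum_irrChar_mul ha ha
      rw [if_pos rfl] at this
      rw [← this, sum_mul]
      exact sum_congr rfl fun g _ => by ring
    · intro b hb hba
      have := sum_irrChar_mul ha hb
      rw [if_neg hba.symm] at this
      calc _ = K a * K b * ∑ g, irrChar n a g * irrChar n b g := by
            rw [mul_sum]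
            exact sum_congr rfl fun g _ => by ring
        _ = 0 := by rw [this, mul_zero]
    · exact fun h => absurd ha h
  have h0 : ∑ g, (S g - T g) ^ 2 = 0 := by
    calc _ = ∑ g, S g * S g - 2 * ∑ g, S g * T g + ∑ g, T g * T g := by
          rw [mul_sum, ← sum_sub_distrib, ← sum_add_distrib]
          exact sum_congr rfl fun g _ => by ring
      _ = 0 := by rw [hSS, hST, hTT]; ring
  have := (sum_eq_zero_iff_of_nonneg fun g _ => sq_nonneg (S g - T g)).1 h0 g (mem_univ g)
  exact sub_eq_zero.1 (pow_eq_zero_iff two_ne_zero |>.1 this)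

/-! ### The dual Cauchy identity -/

/-- The product of two polynomials in separate sets of variables. -/
def ten {n : ℕ} (f g : MvPolynomial (Fin n) ℚ) : MvPolynomial (Fin n) (MvPolynomial (Fin n) ℚ) :=
  MvPolynomial.map MvPolynomial.C f * MvPolynomial.C g

/-- The coefficient of a monomial in the first set of variables. -/
def lcf {n : ℕ} (v : Fin n → ℕ) :
    MvPolynomial (Fin n) (MvPolynomial (Fin n) ℚ) →ₗ[ℚ] MvPolynomial (Fin n) ℚ :=
  (MvPolynomial.lcoeff (MvPolynomial (Fin n) ℚ) (Finsupp.equivFunOnFinite.symm v)).restrictScalars ℚ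

lemma lcf_ten {n : ℕ} (v : Fin n → ℕ) (f g : MvPolynomial (Fin n) ℚ) :
    lcf v (ten f g) = cf v f • g := by
  simp only [lcf, ten, cf, MvPolynomial.lcoeff, LinearMap.coe_restrictScalars, LinearMap.coe_mk,
    AddHom.coe_mk, mul_comm _ (MvPolynomial.C g), MvPolynomial.coeff_C_mul, MvPolynomial.coeff_map, MvPolynomial.smul_eq_C_mul, mul_comm g]

lemma lcf_ext {n : ℕ} {F G : MvPolynomial (Fin n) (MvPolynomial (Fin n) ℚ)}
    (h : ∀ v, lcf v F = lcf v G) : F = G := by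
  refine MvPolynomial.ext _ _ fun m => ?_
  have := h (Finsupp.equivFunOnFinite m)
  simpa [lcf, MvPolynomial.lcoeff] using this

lemma prod_ten {n : ℕ} {ι : Type*} (s : Finset ι) (f g : ι → MvPolynomial (Fin n) ℚ) :
    ∏ i ∈ s, ten (f i) (g i) = ten (∏ i ∈ s, f i) (∏ i ∈ s, g i) := by
  simp only [ten, prod_mul_distrib, map_prod]

lemma ten_sum_sum {n : ℕ} {ι κ : Type*} (s : Finset ι) (t : Finset κ)
    (f : ι → MvPolynomial (Fin n) ℚ) (g : κ → MvPolynomial (Fin n) ℚ) :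
    ten (∑ i ∈ s, f i) (∑ j ∈ t, g j) = ∑ i ∈ s, ∑ j ∈ t, ten (f i) (g j) := by
  simp only [ten, map_sum, sum_mul_sum]

/-- The variables `x j * y i`. -/
def tvar {n : ℕ} (s : Fin n × Fin n) : MvPolynomial (Fin n) (MvPolynomial (Fin n) ℚ) :=
  ten (var s.2) (var s.1)

lemma fixSum_tvar {n : ℕ} (g : Perm (Fin n)) :
    fixSum (tvar (n := n)) g = ten (fixSum var g) (fixSum var g) := by
  simp only [fixSum, ten_sum_sum, tvar, prod_ten]
  rw [← sum_product']
  refine sum_nbij' (fun F => (fun x => (F x).2, fun x => (F x).1)) (fun p x => (p.2 x, p.1 x))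
    ?_ ?_ (fun _ _ => rfl) (fun _ _ => rfl) (fun _ _ => rfl)
  · intro F hF
    simp only [mem_product, mem_filter, mem_univ, true_and] at hF ⊢
    exact ⟨funext fun x => congrArg Prod.snd (congrFun hF x),
      funext fun x => congrArg Prod.fst (congrFun hF x)⟩
  · rintro ⟨h, f⟩ hp
    simp only [mem_product, mem_filter, mem_univ, true_and] at hp ⊢
    exact funext fun x => Prod.ext (congrFun hp.2 x) (congrFun hp.1 x)

lemma esum_tvar {n d : ℕ} (hd : d ≤ n) :
    esum (tvar (n := n)) d = ∑ l ∈ shapes n d, ten (schur n (conjFun n l)) (schur n l) := by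
  refine lcf_ext fun v => ?_
  simp only [esum, tvar, prod_ten, map_sum, lcf_ten, prod_var, cf_mono, ite_smul, one_smul,
    zero_smul, funext_iff]
  have hcard : ∀ S : Finset (Fin n × Fin n), (∀ k, #{s ∈ S | s.2 = k} = v k) → #S = ∑ k, v k :=
    fun S hS => by
      rw [card_eq_sum_card_fiberwise (t := univ) (f := Prod.snd) (by simp)]
      exact sum_congr rfl fun k _ => hS k
  by_cases hv : ∑ k, v k = d
  · have h1 : size n (extc v) = d := by rw [← sum_eq_size, hv]
    have h2 := prod_esum (h1.le.trans hd)
    rw [h1, cf_extc, prod_range] at h2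
    rw [← h2]
    have h3 := prod_esum_families (var (n := n)) v
    rw [← sum_filter]
    refine Eq.trans ?_ (h3.symm.trans (prod_congr rfl fun k _ => by simp [extc]))
    refine sum_congr ?_ fun S _ => ?_
    · ext S
      simp only [mem_filter, mem_powersetCard, subset_univ, true_and, mem_univ]
      exact ⟨fun h => h.2, fun h => ⟨(hcard S h).trans hv, h⟩⟩
    · rw [prod_var]
  · rw [sum_eq_zero, sum_eq_zero]
    · intro l hl
      have := (mem_shapes.1 (conjFun_mem_shapes hd hl)).2
      rw [cf_schur_of_ne (by rwa [this]), zero_smul]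
    · intro S hS
      refine if_neg fun h => hv ?_
      rw [← hcard S h]
      exact (mem_powersetCard.1 hS).2

/-- Pairing a sign twisted permutation character with a product of two characters. -/
lemma sum_sign_mul_mul {n : ℕ} {c : Fin n → ℕ} (hc : ∑ k, c k = n)
    (φ ψ : MvPolynomial (Fin n) ℚ →ₗ[ℚ] ℚ) :
    ∑ g : Perm (Fin n), (((Perm.sign g : ℤ) : ℚ) * cf c (fixSum var g)) *
        (φ (fixSum var g) * ψ (fixSum var g)) =
      n.factorial * ∑ Λ ∈ Fintype.piFinset fun k => shapes n (c k),
        φ (∏ k, schur n (conjFun n (Λ k))) * ψ (∏ k, schur n (Λ k)) := by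
  refine sum_mul_of_kernel (fun v => ?_) φ ψ
  have hle : ∀ k, c k ≤ n := fun k =>
    (single_le_sum (f := c) (fun _ _ => Nat.zero_le _) (mem_univ k)).trans hc.le
  have h1 := sum_sign_cf_fixSum (tvar (n := n)) c hc
  rw [prod_congr rfl fun k _ => esum_tvar (hle k), prod_univ_sum] at h1
  simp only [prod_ten, fixSum_tvar] at h1
  have h2 := congrArg (lcf v) h1
  simp only [map_sum, map_nsmul, map_smul, lcf_ten] at h2
  rw [← h2]
  exact sum_congr rfl fun g _ => by rw [mul_smul]

lemma sum_mul_kron {n : ℕ} {c : ℕ → ℕ} (hc : ∀ k, n ≤ k → c k = 0) (hn : size n c = n)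
    (a b : ℕ → ℕ) :
    ∑ l ∈ shapes n n, cf (fun i => c i) (schur n (conjFun n l)) * kron n a b l =
      ∑ Λ ∈ Fintype.piFinset fun k : Fin n => shapes n (c k),
        schurCoeff n a (∏ k, schur n (Λ k)) *
          schurCoeff n b (∏ k, schur n (conjFun n (Λ k))) := by
  have h1 := sum_sign_mul_mul (n := n) (c := fun k => c k) ((sum_range c).symm.trans hn)
    (schurCoeff n b) (schurCoeff n a)
  simp only [← permChar_eq hc, ← irrChar_eq, sign_mul_permChar hc] at h1
  have h2 : (n.factorial : ℚ) ≠ 0 := Nat.cast_ne_zero.2 n.factorial_ne_zero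
  refine mul_left_cancel₀ h2 ?_
  rw [sum_congr rfl fun Λ _ => mul_comm _ (schurCoeff n b _), ← h1, mul_sum]
  simp only [kron, innerChar, sum_mul]
  rw [sum_comm]
  refine sum_congr rfl fun l _ => ?_
  rw [mul_div_assoc', mul_div_assoc', mul_div_cancel_left₀ _ h2, mul_sum]
  exact sum_congr rfl fun g _ => by ring

/-- The number of chains of Littlewood–Richardson patterns with contents `Λ 0, …, Λ (m - 1)`. -/
def lrChain (n : ℕ) (Λ : ℕ → ℕ → ℕ) : ℕ → (ℕ → ℕ) → ℕ :=
  chainCount n (fun m => ∑ k ∈ range m, size n (Λ k)) fun k a b => lrPat n (Λ k) a b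

lemma schurCoeff_prod {n m : ℕ} {Λ : ℕ → ℕ → ℕ} {a : ℕ → ℕ}
    (ha : a ∈ shapes n (∑ k ∈ range m, size n (Λ k))) :
    schurCoeff n a (∏ k ∈ range m, schur n (Λ k)) = lrChain n Λ m a := by
  rw [schurCoeff_apply, prod_mul_alt (s := fun m => ∑ k ∈ range m, size n (Λ k))
    (c := fun k => size n (Λ k)) (W := fun k a b => lrPat n (Λ k) a b) (fun k => schur n (Λ k))
    (sum_range_zero _) (fun k => sum_range_succ _ k) (fun k a ha => alt_mul_schur ha (Λ k)) m]
  simp only [map_sum, map_smul, smul_eq_mul]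
  rw [sum_eq_single a]
  · rw [cf_alt (mem_shapes.1 ha).1 (mem_shapes.1 ha).1, if_pos rfl, mul_one]
    rfl
  · intro l hl hla
    rw [cf_alt (mem_shapes.1 ha).1 (mem_shapes.1 hl).1, if_neg hla, mul_zero]
  · exact fun h => absurd ha h

/-! ### Fillings with weakly increasing rows as chains of shapes -/

lemma card_cells {m : ℕ} {l u : ℕ → ℕ} {P : ℕ × ℕ → Prop}
    (h : ∀ i j, P (i, j) ↔ i < m ∧ l i ≤ j ∧ j < u i) :
    Nat.card {p : ℕ × ℕ // P p} = ∑ i ∈ range m, (u i - l i) := by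
  rw [Nat.subtype_card (((range m).sigma fun i => Ico (l i) (u i)).map
      (Equiv.sigmaEquivProd ℕ ℕ).toEmbedding), card_map, card_sigma]
  · simp only [Nat.card_Ico]
  rintro ⟨i, j⟩
  rw [mem_map_equiv, h]
  simp

lemma lt_card_filter_range {N : ℕ} {P : ℕ → Prop} (hP : ∀ i j, i ≤ j → j < N → P j → P i) (j : ℕ) :
    j < #{i ∈ range N | P i} ↔ j < N ∧ P j := by
  constructor
  · intro hj
    by_contra hn
    have : {i ∈ range N | P i} ⊆ range j := fun k hk => by
      rw [mem_filter, mem_range] at hk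
      rw [mem_range]
      by_contra hkj
      exact hn ⟨(not_lt.1 hkj).trans_lt hk.1, hP j k (not_lt.1 hkj) hk.1 hk.2⟩
    have := card_le_card this
    rw [card_range] at this
    exact absurd hj (not_lt.2 this)
  · rintro ⟨hj, hPj⟩
    have : range (j + 1) ⊆ {i ∈ range N | P i} := fun k hk => by
      rw [mem_range] at hk
      rw [mem_filter, mem_range]
      exact ⟨by omega, hP k j (by omega) hj hPj⟩
    have := card_le_card this
    rwa [card_range] at this

/-- Fillings of the skew shape `α/μ` with weakly increasing rows and entries less than `n`. -/
structure IsFilling (n : ℕ) (α μ : ℕ → ℕ) (T : ℕ → ℕ → ℕ) : Prop where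
  outside : ∀ i j, ¬(μ i ≤ j ∧ j < α i) → T i j = 0
  row : ∀ i j₁ j₂, μ i ≤ j₁ → j₁ ≤ j₂ → j₂ < α i → T i j₁ ≤ T i j₂
  lt : ∀ i j, μ i ≤ j → j < α i → T i j < n

/-- Chains of compositions from `μ` to `α` with `n` steps. -/
structure IsFlag (n : ℕ) (α μ : ℕ → ℕ) (q : ℕ → ℕ → ℕ) : Prop where
  zero : q 0 = μ
  last : ∀ v, n ≤ v → q v = α
  le : ∀ v i, q v i ≤ q (v + 1) i

/-- The cells of `q v` not in `μ` are those where the entry of `T` is less than `v`. -/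
def Corresponds (α μ : ℕ → ℕ) (T q : ℕ → ℕ → ℕ) : Prop :=
  ∀ i j v, μ i ≤ j → j < α i → (T i j < v ↔ j < q v i)

/-- The chain of a filling. -/
def chainOf (α μ : ℕ → ℕ) (T : ℕ → ℕ → ℕ) : ℕ → ℕ → ℕ :=
  fun v i => #{j ∈ range (α i) | j < μ i ∨ T i j < v}

/-- The filling of a chain. -/
def fillingOf (n : ℕ) (α μ : ℕ → ℕ) (q : ℕ → ℕ → ℕ) : ℕ → ℕ → ℕ :=
  fun i j => if μ i ≤ j ∧ j < α i then #{v ∈ range n | q (v + 1) i ≤ j} else 0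

section
variable {n : ℕ} {α μ : ℕ → ℕ} {T q : ℕ → ℕ → ℕ}

namespace IsFlag

lemma mono (h : IsFlag n α μ q) (i : ℕ) : Monotone fun v => q v i :=
  monotone_nat_of_le_succ fun v => h.le v i

lemma le_last (h : IsFlag n α μ q) (v i : ℕ) : q v i ≤ α i := by
  have := h.mono i (le_max_left v n)
  rwa [← h.last (max v n) (le_max_right _ _)]

lemma zero_le (h : IsFlag n α μ q) (v i : ℕ) : μ i ≤ q v i :=
  h.zero ▸ h.mono i (Nat.zero_le v)

lemma corresponds (h : IsFlag n α μ q) : Corresponds α μ (fillingOf n α μ q) q := by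
  intro i j v h1 h2
  have h3 := lt_card_filter_range (N := n) (P := fun v => q (v + 1) i ≤ j)
    fun u v huv _ hv => (h.mono i (Nat.succ_le_succ huv)).trans hv
  rw [fillingOf, if_pos ⟨h1, h2⟩]
  rcases v with _ | v
  · rw [h.zero]
    omega
  · have h4 : v < #{v ∈ range n | q (v + 1) i ≤ j} ↔ v < n ∧ q (v + 1) i ≤ j := by
      convert h3 v
    rw [Nat.lt_succ_iff, ← not_lt, h4]
    constructor
    · intro h5
      by_contra h6
      refine h5 ⟨?_, not_lt.1 h6⟩
      by_contra h7
      rw [h.last (v + 1) (by omega)] at h6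
      exact h6 h2
    · intro h5 h6
      omega

lemma isFilling (h : IsFlag n α μ q) : IsFilling n α μ (fillingOf n α μ q) := by
  refine ⟨fun i j hij => if_neg hij, fun i j₁ j₂ h1 h2 h3 => ?_, fun i j h1 h2 => ?_⟩
  · by_contra h4
    have h5 := (h.corresponds i j₂ _ (h1.trans h2) h3).1 (not_le.1 h4)
    have h6 := (h.corresponds i j₁ _ h1 (h2.trans_lt h3)).2 (h2.trans_lt h5)
    exact lt_irrefl _ h6
  · rw [h.corresponds i j n h1 h2, h.last n le_rfl]
    exact h2

end IsFlag

namespace IsFilling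

lemma lt_chainOf (h : IsFilling n α μ T) (v i j : ℕ) :
    j < chainOf α μ T v i ↔ j < α i ∧ (j < μ i ∨ T i j < v) := by
  have := lt_card_filter_range (N := α i) (P := fun j => j < μ i ∨ T i j < v)
    (fun j₁ j₂ h1 h2 h3 => by
      by_cases h4 : j₁ < μ i
      · exact Or.inl h4
      · have := h.row i j₁ j₂ (not_lt.1 h4) h1 h2
        omega) j
  rw [chainOf]
  convert this

lemma corresponds (h : IsFilling n α μ T) : Corresponds α μ T (chainOf α μ T) := by
  intro i j v h1 h2
  rw [h.lt_chainOf]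
  omega

lemma isChain (hμ : ∀ i, μ i ≤ α i) (h : IsFilling n α μ T) :
    IsFlag n α μ (chainOf α μ T) := by
  refine ⟨?_, fun v hv => ?_, fun v i => ?_⟩
  · funext i
    refine eq_of_forall_lt_iff fun j => ?_
    rw [h.lt_chainOf]
    have := hμ i
    omega
  · funext i
    refine eq_of_forall_lt_iff fun j => ?_
    rw [h.lt_chainOf]
    constructor
    · exact fun h1 => h1.1
    · intro h1
      refine ⟨h1, ?_⟩
      by_cases h2 : j < μ i
      · exact Or.inl h2
      · exact Or.inr ((h.lt i j (not_lt.1 h2) h1).trans_le hv)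
  · refine le_of_forall_lt fun j => ?_
    rw [h.lt_chainOf, h.lt_chainOf]
    omega

end IsFilling

/-- Fillings and chains are in bijection. -/
lemma card_fillings (hμ : ∀ i, μ i ≤ α i) (P Q : (ℕ → ℕ → ℕ) → Prop)
    (hPQ : ∀ T q, IsFilling n α μ T → IsFlag n α μ q → Corresponds α μ T q → (P T ↔ Q q)) :
    Nat.card {T // IsFilling n α μ T ∧ P T} = Nat.card {q // IsFlag n α μ q ∧ Q q} := by
  refine Nat.card_congr ⟨
    fun T => ⟨chainOf α μ T.1, T.2.1.isChain hμ,
      (hPQ _ _ T.2.1 (T.2.1.isChain hμ) T.2.1.corresponds).1 T.2.2⟩,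
    fun q => ⟨fillingOf n α μ q.1, q.2.1.isFilling,
      (hPQ _ _ q.2.1.isFilling q.2.1 q.2.1.corresponds).2 q.2.2⟩, fun T => ?_, fun q => ?_⟩
  · refine Subtype.ext (funext fun i => funext fun j => ?_)
    by_cases h : μ i ≤ j ∧ j < α i
    · refine eq_of_forall_gt_iff fun v => ?_
      rw [(T.2.1.isChain hμ).corresponds i j v h.1 h.2, T.2.1.corresponds i j v h.1 h.2]
    · rw [T.2.1.outside i j h]
      exact if_neg h
  · refine Subtype.ext (funext fun v => funext fun i => ?_)
    refine eq_of_forall_lt_iff fun j => ?_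
    change j < chainOf α μ (fillingOf n α μ q.1) v i ↔ _
    rw [q.2.1.isFilling.lt_chainOf]
    have h1 := q.2.1.le_last v i
    have h2 := q.2.1.zero_le v i
    by_cases h : μ i ≤ j ∧ j < α i
    · rw [q.2.1.corresponds i j v h.1 h.2]
      omega
    · omega

lemma colStrict_iff (hα : Antitone α) (hμ : Antitone μ) (hq : IsFlag n α μ q)
    (h : Corresponds α μ T q) :
    (∀ i₁ i₂ j, i₁ < i₂ → μ i₁ ≤ j → j < α i₁ → μ i₂ ≤ j → j < α i₂ → T i₁ j < T i₂ j) ↔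
      ∀ v i, q (v + 1) (i + 1) ≤ q v i := by
  constructor
  · intro hT v i
    refine le_of_forall_lt fun j hj => ?_
    have h1 := hμ (Nat.le_succ i)
    have h2 := hα (Nat.le_succ i)
    have h3 := hq.le_last (v + 1) (i + 1)
    have h4 := hq.zero_le v i
    simp only [Nat.succ_eq_add_one] at h1 h2
    by_cases h5 : j < μ i
    · omega
    · have h6 := (h (i + 1) j (v + 1) (by omega) (by omega)).2 hj
      have h7 := hT i (i + 1) j (Nat.lt_succ_self i) (by omega) (by omega) (by omega) (by omega)
      exact (h i j v (by omega) (by omega)).1 (by omega)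
  · intro hT i₁ i₂ j hi h1 h2 h3 h4
    have hanti : ∀ v, Antitone (q v) := fun v =>
      antitone_nat_of_succ_le fun i => (hq.le v (i + 1)).trans (hT v i)
    obtain ⟨k, rfl⟩ : ∃ k, i₂ = k + 1 := ⟨i₂ - 1, by omega⟩
    rw [h i₁ j _ h1 h2]
    have h5 := (h (k + 1) j (T (k + 1) j + 1) h3 h4).1 (Nat.lt_succ_self _)
    exact (h5.trans_le (hT _ k)).trans_le (hanti _ (by omega))

lemma mem_cell_iff (hq : IsFlag n α μ q) (h : Corresponds α μ T q) (i j v : ℕ) :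
    μ i ≤ j ∧ j < α i ∧ T i j = v ↔ q v i ≤ j ∧ j < q (v + 1) i := by
  have h1 := hq.le_last (v + 1) i
  have h2 := hq.zero_le v i
  by_cases h3 : μ i ≤ j ∧ j < α i
  · have h4 := h i j v h3.1 h3.2
    have h5 := h i j (v + 1) h3.1 h3.2
    omega
  · omega

lemma skewContent_eq (hα : IsShape n α) (hq : IsFlag n α μ q) (h : Corresponds α μ T q) (v : ℕ) :
    skewContent α μ T v = size n fun i => q (v + 1) i - q v i := by
  refine card_cells fun i j => ?_
  simp only [mem_cell_iff hq h]
  refine ⟨fun hj => ⟨?_, hj⟩, fun hj => hj.2⟩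
  by_contra hi
  have := hq.le_last (v + 1) i
  have := hα.zero i (not_lt.1 hi)
  omega

lemma lrCount_eq (hq : IsFlag n α μ q) (h : Corresponds α μ T q) (i j v : ℕ) :
    lrCount α μ T i j v =
      size i (fun i => q (v + 1) i - q v i) + (q (v + 1) i - max j (q v i)) := by
  rw [lrCount, card_cells (m := i + 1) (l := fun k => if k < i then q v k else max j (q v k))
    (u := q (v + 1))]
  · rw [sum_range_succ, if_neg (lt_irrefl i)]
    congr 1
    exact sum_congr rfl fun k hk => by rw [if_pos (mem_range.1 hk)]
  · intro k l
    simp only [mem_cell_iff hq h]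
    split_ifs <;> omega

lemma lattice_iff (hq : IsFlag n α μ q) (h : Corresponds α μ T q) :
    (∀ i j v, lrCount α μ T i j (v + 1) ≤ lrCount α μ T i j v) ↔
      ∀ i v, size (i + 1) (fun i => q (v + 2) i - q (v + 1) i) ≤
        size i (fun i => q (v + 1) i - q v i) := by
  simp only [lrCount_eq hq h, size_succ]
  constructor
  · intro hT i v
    have := hT i (q (v + 1) i) v
    have h1 := hq.le v i
    rw [max_self, max_eq_left h1] at this
    simpa using this
  · intro hT i j v
    have h1 := hT i v
    have h2 : q (v + 1 + 1) i - max j (q (v + 1) i) ≤ q (v + 2) i - q (v + 1) i :=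
      Nat.sub_le_sub_left (le_max_right _ _) _
    simp only [show v + 1 + 1 = v + 2 from rfl] at h2 ⊢
    omega

end

/-! ### Tableaux as patterns -/

lemma size_sub_add {n : ℕ} {a b : ℕ → ℕ} (h : ∀ i, b i ≤ a i) :
    size n (fun i => a i - b i) + size n b = size n a := by
  rw [size, size, ← sum_add_distrib]
  exact sum_congr rfl fun i _ => Nat.sub_add_cancel (h i)

lemma size_eq_of_le {n m : ℕ} {a : ℕ → ℕ} (hnm : n ≤ m) (h : ∀ i, n ≤ i → a i = 0) :
    size m a = size n a := by
  induction m, hnm using Nat.le_induction with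
  | base => rfl
  | succ m hm ih => rw [size_succ, ih, h m hm, add_zero]

lemma finite_cells {n : ℕ} {a : ℕ → ℕ} (h : IsShape n a) {P : ℕ × ℕ → Prop}
    (hP : ∀ i j, P (i, j) → j < a i) : Finite {p : ℕ × ℕ // P p} := by
  refine Set.Finite.subset ((range n ×ˢ range (a 0)).finite_toSet) ?_
  rintro ⟨i, j⟩ hp
  have hj := hP i j hp
  simp only [SetLike.mem_coe, mem_product, mem_range]
  refine ⟨?_, hj.trans_le (h.anti (Nat.zero_le i))⟩
  by_contra hi
  rw [h.zero i (not_lt.1 hi)] at hj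
  exact absurd hj (Nat.not_lt_zero j)

section
variable {n : ℕ} {α μ c : ℕ → ℕ} {T q : ℕ → ℕ → ℕ}

lemma skewContent_pos (hα : IsShape n α) {i j : ℕ} (h1 : μ i ≤ j) (h2 : j < α i) :
    0 < skewContent α μ T (T i j) := by
  have : Finite {p : ℕ × ℕ // μ p.1 ≤ p.2 ∧ p.2 < α p.1 ∧ T p.1 p.2 = T i j} :=
    finite_cells hα fun _ _ h => h.2.1
  have : Nonempty {p : ℕ × ℕ // μ p.1 ≤ p.2 ∧ p.2 < α p.1 ∧ T p.1 p.2 = T i j} :=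
    ⟨⟨(i, j), h1, h2, rfl⟩⟩
  exact Nat.card_pos

/-- The Kostka number counts Gelfand–Tsetlin patterns. -/
lemma kostka_eq (hα : IsShape n α) (hc : ∀ k, n ≤ k → c k = 0) :
    kostka α c = #(patternsOf n c α n) := by
  have h1 : ∀ T, (IsSSYT α T ∧ ∀ k, skewContent α (fun _ => 0) T k = c k) ↔
      IsFilling n α (fun _ => 0) T ∧
        (∀ i₁ i₂ j, i₁ < i₂ → 0 ≤ j → j < α i₁ → 0 ≤ j → j < α i₂ → T i₁ j < T i₂ j) ∧
          ∀ k, skewContent α (fun _ => 0) T k = c k := by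
    refine fun T => ⟨fun ⟨⟨h1, h2, h3⟩, h4⟩ => ⟨⟨fun i j hij => h1 i j (by omega),
      fun i j₁ j₂ _ => h2 i j₁ j₂, fun i j _ hj => ?_⟩,
      fun i₁ i₂ j hi _ _ _ => h3 i₁ i₂ j hi, h4⟩,
      fun ⟨⟨h1, h2, _⟩, h3, h4⟩ => ⟨⟨fun i j hij => h1 i j (by omega),
        fun i j₁ j₂ => h2 i j₁ j₂ (Nat.zero_le _), fun i₁ i₂ j hi hj =>
          h3 i₁ i₂ j hi (Nat.zero_le _) (hj.trans_le (hα.anti hi.le)) (Nat.zero_le _) hj⟩, h4⟩⟩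
    by_contra h5
    have h6 := skewContent_pos (μ := fun _ => 0) (T := T) hα (Nat.zero_le j) hj
    rw [h4, hc _ (not_lt.1 h5)] at h6
    exact lt_irrefl _ h6
  rw [kostka, Nat.card_congr (Equiv.subtypeEquivRight h1),
    card_fillings (fun i => Nat.zero_le _) _
      (fun q => (∀ v i, q (v + 1) (i + 1) ≤ q v i) ∧
        ∀ v, size n (fun i => q (v + 1) i - q v i) = c v)
      fun T q _ hq h => and_congr (colStrict_iff hα.anti (fun _ _ _ => le_rfl) hq h)
        (forall_congr' fun v => by rw [skewContent_eq hα hq h])]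
  refine Nat.subtype_card _ fun q => ?_
  rw [patternsOf, mem_filter, mem_patterns]
  constructor
  · rintro ⟨h, hs⟩
    refine ⟨⟨funext h.zero, h.last, fun v i => (h.strip v i).1⟩, fun v i => (h.strip v i).2,
      fun v => ?_⟩
    have h2 := size_sub_add (n := n) fun i => (h.strip v i).1
    by_cases hv : v < n
    · rw [hs v hv.le, hs (v + 1) hv, size_succ] at h2
      omega
    · rw [h.last v (not_lt.1 hv), h.last (v + 1) (by omega)] at h2
      rw [h.last v (not_lt.1 hv), h.last (v + 1) (by omega), hc v (not_lt.1 hv)]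
      omega
  · rintro ⟨h, hcol, hs⟩
    refine ⟨⟨fun k => by rw [h.zero], h.last, fun v i => ⟨h.le v i, hcol v i⟩⟩, fun i _ => ?_⟩
    induction i with
    | zero => rw [h.zero]; simp [size]
    | succ i ih =>
      rw [← size_sub_add (h.le i), hs, ih (by omega), size_succ, add_comm]

/-- In a Littlewood–Richardson filling, the entries of row `i` are at most `i`. -/
lemma le_row_of_isLR (hα : IsShape n α) (h : IsLR α μ T) (i j : ℕ) (h1 : μ i ≤ j) (h2 : j < α i) :
    T i j ≤ i := by
  induction i using Nat.strong_induction_on generalizing j with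
  | _ i ih =>
  rcases hk : T i j with _ | k
  · exact Nat.zero_le i
  have hfin : ∀ v, Finite {p : ℕ × ℕ //
      (p.1 < i ∨ (p.1 = i ∧ j ≤ p.2)) ∧ μ p.1 ≤ p.2 ∧ p.2 < α p.1 ∧ T p.1 p.2 = v} := fun v =>
    finite_cells hα fun _ _ h => h.2.2.1
  have hne : Nonempty {p : ℕ × ℕ //
      (p.1 < i ∨ (p.1 = i ∧ j ≤ p.2)) ∧ μ p.1 ≤ p.2 ∧ p.2 < α p.1 ∧ T p.1 p.2 = k + 1} :=
    ⟨⟨(i, j), Or.inr ⟨rfl, le_rfl⟩, h1, h2, hk⟩⟩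
  have hpos : 0 < lrCount α μ T i j (k + 1) := @Nat.card_pos _ hne (hfin _)
  obtain ⟨⟨⟨i', j'⟩, h3, h4, h5, h6⟩⟩ := (Nat.card_pos_iff.1 (hpos.trans_le (h.2.2.2 i j k))).1
  simp only at h3 h4 h5 h6
  rcases h3 with h3 | ⟨rfl, h3⟩
  · have := ih i' h3 j' h4 h5
    omega
  · have := h.2.1 i' j j' h1 h3 h5
    omega

/-- Chains corresponding to Littlewood–Richardson fillings of content `l`. -/
structure IsLRFlag (n : ℕ) (α μ l : ℕ → ℕ) (q : ℕ → ℕ → ℕ) : Prop extends IsFlag n α μ q where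
  col : ∀ v i, q (v + 1) (i + 1) ≤ q v i
  lattice : ∀ i v, size (i + 1) (fun i => q (v + 2) i - q (v + 1) i) ≤
    size i (fun i => q (v + 1) i - q v i)
  content : ∀ v, size n (fun i => q (v + 1) i - q v i) = l v

lemma card_isLR_eq_card_isLRFlag (hα : IsShape n α) (hμ : IsShape n μ) (hle : ∀ i, μ i ≤ α i)
    (l : ℕ → ℕ) :
    Nat.card {T // IsLR α μ T ∧ skewContent α μ T = l} = Nat.card {q // IsLRFlag n α μ l q} := by
  have h1 : ∀ T, (IsLR α μ T ∧ skewContent α μ T = l) ↔ IsFilling n α μ T ∧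
      (∀ i₁ i₂ j, i₁ < i₂ → μ i₁ ≤ j → j < α i₁ → μ i₂ ≤ j → j < α i₂ → T i₁ j < T i₂ j) ∧
      (∀ i j v, lrCount α μ T i j (v + 1) ≤ lrCount α μ T i j v) ∧
      ∀ v, skewContent α μ T v = l v := by
    refine fun T => ⟨fun ⟨h, h5⟩ => ⟨⟨h.1, h.2.1, fun i j h1 h2 => ?_⟩, h.2.2.1, h.2.2.2,
      congrFun h5⟩, fun ⟨h1, h3, h4, h5⟩ => ⟨⟨h1.1, h1.2, h3, h4⟩, funext h5⟩⟩
    refine (le_row_of_isLR hα h i j h1 h2).trans_lt ?_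
    by_contra hi
    rw [hα.zero i (not_lt.1 hi)] at h2
    exact absurd h2 (Nat.not_lt_zero j)
  rw [Nat.card_congr (Equiv.subtypeEquivRight h1), card_fillings hle _
      (fun q => (∀ v i, q (v + 1) (i + 1) ≤ q v i) ∧
        (∀ i v, size (i + 1) (fun i => q (v + 2) i - q (v + 1) i) ≤
          size i (fun i => q (v + 1) i - q v i)) ∧
        ∀ v, size n (fun i => q (v + 1) i - q v i) = l v)
      fun T q _ hq h => and_congr (colStrict_iff hα.anti hμ.anti hq h)
        (and_congr (lattice_iff hq h) (forall_congr' fun v => by rw [skewContent_eq hα hq h]))]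
  exact Nat.card_congr (Equiv.subtypeEquivRight fun q =>
    ⟨fun ⟨h1, h2, h3, h4⟩ => ⟨h1, h2, h3, h4⟩, fun h => ⟨h.1, h.2, h.3, h.4⟩⟩)

/-- The companion pattern of a chain: level `i` is the content of the first `i` rows. -/
def companion (q : ℕ → ℕ → ℕ) : ℕ → ℕ → ℕ := fun i v => size i fun i => q (v + 1) i - q v i

/-- The chain with a given companion pattern. -/
def flagOf (μ : ℕ → ℕ) (p : ℕ → ℕ → ℕ) : ℕ → ℕ → ℕ :=
  fun v i => μ i + (size v (p (i + 1)) - size v (p i))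

lemma IsFlag.size_companion (h : IsFlag n α μ q) (v i : ℕ) :
    size v (companion q (i + 1)) = size v (companion q i) + (q v i - μ i) := by
  induction v with
  | zero => simp [size, h.zero]
  | succ v ih =>
    have h1 := h.zero_le v i
    have h2 := h.le v i
    rw [size_succ, size_succ, ih, companion, companion, size_succ]
    omega

lemma IsLRFlag.isGT {l : ℕ → ℕ} (hα : IsShape n α) (h : IsLRFlag n α μ l q) :
    IsGT n l (companion q) := by
  refine ⟨fun k => by simp [companion, size], fun i hi => funext fun v => ?_,
    fun i v => ⟨?_, h.lattice i v⟩⟩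
  · rw [companion, ← h.content v]
    refine size_eq_of_le hi fun k hk => ?_
    have h1 := h.toIsFlag.le_last (v + 1) k
    have h2 := hα.zero k hk
    omega
  · rw [companion, companion, size_succ]
    exact Nat.le_add_right _ _

lemma IsLRFlag.good {l : ℕ → ℕ} (h : IsLRFlag n α μ l q) : Good n μ (companion q) := by
  rintro k i ⟨-, hk⟩
  rw [h.size_companion k i, h.size_companion (k + 1) (i + 1)] at hk
  have h1 := h.zero_le k i
  have h2 := h.zero_le (k + 1) (i + 1)
  have h3 := h.col k i
  omega

lemma IsLRFlag.addVec_companion {l : ℕ → ℕ} (hα : IsShape n α) (hμ : IsShape n μ)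
    (hle : ∀ i, μ i ≤ α i) (h : IsLRFlag n α μ l q) : addVec μ (wt n (companion q)) = α := by
  funext i
  simp only [addVec, extc, wt]
  split_ifs with hi
  · have := hle i
    rw [h.size_companion, h.last n le_rfl]
    omega
  · rw [hα.zero i (not_lt.1 hi), hμ.zero i (not_lt.1 hi)]

lemma flagOf_succ {l : ℕ → ℕ} {p : ℕ → ℕ → ℕ} (h : IsGT n l p) (v i : ℕ) :
    flagOf μ p (v + 1) i = flagOf μ p v i + (p (i + 1) v - p i v) := by
  have h1 := (h.strip i v).1
  have h2 : size v (p i) ≤ size v (p (i + 1)) := size_mono fun k => (h.strip i k).1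
  simp only [flagOf, size_succ]
  omega

lemma companion_flagOf {l : ℕ → ℕ} {p : ℕ → ℕ → ℕ} (h : IsGT n l p) :
    companion (flagOf μ p) = p := by
  funext i v
  simp only [companion, flagOf_succ h, Nat.add_sub_cancel_left]
  induction i with
  | zero => simp [size, h.zero]
  | succ i ih =>
    rw [size_succ, ih]
    exact Nat.add_sub_cancel' (h.strip i v).1

lemma isLRFlag_flagOf {l : ℕ → ℕ} {p : ℕ → ℕ → ℕ} (hα : IsShape n α)
    (h : IsGT n l p) (hg : Good n μ p) (hw : addVec μ (wt n p) = α) :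
    IsLRFlag n α μ l (flagOf μ p) := by
  have hflag : IsFlag n α μ (flagOf μ p) := by
    refine ⟨by funext i; simp [flagOf, size], fun v hv => ?_, fun v i => ?_⟩
    · rw [← hw]
      funext i
      simp only [flagOf, addVec, extc, wt]
      split_ifs with hi
      · rw [size_eq_of_le hv (h.eq_zero' _), size_eq_of_le hv (h.eq_zero' _)]
      · rw [h.last i (not_lt.1 hi), h.last (i + 1) (by omega), Nat.sub_self]
    · rw [flagOf_succ h]
      exact Nat.le_add_right _ _
  refine ⟨hflag, fun v i => ?_, fun i v => ?_, fun v => ?_⟩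
  · by_cases hi : i + 1 < n
    · have h1 := hg v i
      have h2 : size v (p i) ≤ size v (p (i + 1)) := size_mono fun k => (h.strip i k).1
      have h3 : size (v + 1) (p (i + 1)) ≤ size (v + 1) (p (i + 2)) :=
        size_mono fun k => (h.strip (i + 1) k).1
      simp only [BadAt, not_and, not_lt] at h1
      have h1 := h1 hi
      simp only [flagOf]
      change μ (i + 1) + (size (v + 1) (p (i + 2)) - _) ≤ _
      omega
    · have h1 := hflag.le_last (v + 1) (i + 1)
      have h2 := hα.zero (i + 1) (not_lt.1 hi)
      omega
  · have := (h.strip i v).2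
    rwa [← companion_flagOf (μ := μ) h] at this
  · have := congrFun (h.last n le_rfl) v
    rwa [← companion_flagOf (μ := μ) h] at this

/-- Littlewood–Richardson fillings are counted by `lrPat`. -/
lemma card_isLR (hα : IsShape n α) (hμ : IsShape n μ) (hle : ∀ i, μ i ≤ α i) (l : ℕ → ℕ) :
    Nat.card {T // IsLR α μ T ∧ skewContent α μ T = l} = lrPat n l μ α := by
  rw [card_isLR_eq_card_isLRFlag hα hμ hle]
  have : Nat.card {p // IsGT n l p ∧ Good n μ p ∧ addVec μ (wt n p) = α} = lrPat n l μ α :=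
    Nat.subtype_card _ fun p => by rw [mem_filter, mem_patterns]
  rw [← this]
  refine Nat.card_congr ⟨
    fun q => ⟨companion q.1, q.2.isGT hα, q.2.good, q.2.addVec_companion hα hμ hle⟩,
    fun p => ⟨flagOf μ p.1, isLRFlag_flagOf hα p.2.1 p.2.2.1 p.2.2.2⟩,
    fun q => Subtype.ext (funext fun v => funext fun i => ?_),
    fun p => Subtype.ext (companion_flagOf p.2.1)⟩
  have := q.2.zero_le v i
  simp only [flagOf, q.2.size_companion]
  omega

lemma lrPat_eq_zero (h : ¬∀ i, μ i ≤ α i) (l : ℕ → ℕ) : lrPat n l μ α = 0 := by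
  refine card_eq_zero.2 (filter_eq_empty_iff.2 fun p _ hp => h fun i => ?_)
  rw [← hp.2]
  exact Nat.le_add_right _ _

end

/-! ### Littlewood–Richardson multitableaux -/

lemma sum_card_fiber {X A : Type*} {s : Finset A} (f : X → A) (hf : ∀ x, f x ∈ s)
    [∀ a, Finite {x // f x = a}] :
    Finite X ∧ Nat.card X = ∑ a ∈ s, Nat.card {x // f x = a} := by
  have e : X ≃ Σ a : s, {x // f x = a} :=
    ⟨fun x => ⟨⟨f x, hf x⟩, x, rfl⟩, fun y => y.2.1, fun _ => rfl, by
      rintro ⟨⟨a, ha⟩, x, hx⟩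
      simp only at hx
      subst hx
      rfl⟩
  refine ⟨Finite.of_equiv _ e.symm, ?_⟩
  rw [Nat.card_congr e, Nat.card_sigma, ← sum_coe_sort s]

section
variable {n : ℕ} {α μ : ℕ → ℕ}

lemma finite_isLR (hα : IsShape n α) (P : (ℕ → ℕ → ℕ) → Prop) :
    Finite {T // IsLR α μ T ∧ P T} := by
  have hlt : ∀ T : {T // IsLR α μ T ∧ P T}, ∀ i j, T.1 i j < i + 1 := by
    intro T i j
    by_cases h : μ i ≤ j ∧ j < α i
    · exact Nat.lt_succ_of_le (le_row_of_isLR hα T.2.1 i j h.1 h.2)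
    · rw [T.2.1.1 i j h]
      exact Nat.succ_pos i
  refine Finite.of_injective (β := (i : Fin n) → Fin (α i) → Fin (i + 1))
    (fun T i j => ⟨T.1 i j, hlt T i j⟩) fun T T' h => Subtype.ext (funext fun i => funext fun j => ?_)
  by_cases hj : j < α i
  · have hi : i < n := by
      by_contra hi
      rw [hα.zero i (not_lt.1 hi)] at hj
      exact absurd hj (Nat.not_lt_zero j)
    exact congrArg Fin.val (congrFun (congrFun h ⟨i, hi⟩) ⟨j, hj⟩)
  · rw [T.2.1.1 i j fun h => hj h.2, T'.2.1.1 i j fun h => hj h.2]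

lemma isShape_skewContent (hα : IsShape n α) (hμ : IsShape n μ) (hle : ∀ i, μ i ≤ α i)
    {T : ℕ → ℕ → ℕ} (h : IsLR α μ T) : IsShape n (skewContent α μ T) ∧
      size n α = size n μ + size n (skewContent α μ T) := by
  have h1 := card_isLR hα hμ hle (skewContent α μ T)
  have h2 : 0 < lrPat n (skewContent α μ T) μ α := by
    rw [← h1]
    have := finite_isLR (μ := μ) hα fun T' => skewContent α μ T' = skewContent α μ T
    have : Nonempty {T' // IsLR α μ T' ∧ skewContent α μ T' = skewContent α μ T} := ⟨⟨T, h, rfl⟩⟩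
    exact Nat.card_pos
  obtain ⟨p, hp⟩ := card_pos.1 h2
  rw [mem_filter, mem_patterns] at hp
  refine ⟨hp.1.isShape, ?_⟩
  rw [← sum_wt hp.1, ← size_addVec, hp.2.2]

lemma skewSize_add (hα : IsShape n α) (hle : ∀ i, μ i ≤ α i) :
    skewSize α μ + size n μ = size n α := by
  rw [← size_sub_add hle, skewSize, size]
  congr 1
  refine card_cells fun i j => ⟨fun h => ⟨?_, h⟩, fun h => h.2⟩
  simp only at h
  by_contra hi
  have := hα.zero i (not_lt.1 hi)
  omega

end

namespace LRMulti
variable {n r : ℕ} {α β : ℕ → ℕ}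

lemma chain_le (M : LRMultiF r α) (k : Fin (r + 1)) (i : ℕ) : M.chain k i ≤ α i := by
  rw [← M.last i]
  exact (Fin.monotone_iff_le_succ (f := fun k => M.chain k i)).2 (fun k => M.mono k i)
    (Fin.le_last k)

lemma isShape (hα : IsShape n α) (M : LRMultiF r α) (k : Fin (r + 1)) :
    IsShape n (M.chain k) :=
  ⟨fun i j h => M.antitone k i j h, fun i hi =>
    Nat.le_zero.1 ((chain_le M k i).trans (hα.zero i hi).le)⟩

lemma isShape_cont (hα : IsShape n α) (M : LRMultiF r α) (k : Fin r) :
    IsShape n (M.cont k) ∧ size n (M.cont k) = M.size k := by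
  have h1 := isShape_skewContent (isShape hα M k.succ) (isShape hα M k.castSucc) (M.mono k) (M.lr k)
  refine ⟨h1.1, ?_⟩
  have h2 := skewSize_add (isShape hα M k.succ) (M.mono k)
  rw [LRMultiF.cont, LRMultiF.size]
  omega

lemma ext {M N : LRMultiF r α} (h1 : M.chain = N.chain) (h2 : M.T = N.T) : M = N := by
  cases M; cases N; congr

/-- Removes the last tableau. -/
def init (M : LRMultiF (r + 1) α) {a : ℕ → ℕ} (h : M.chain (Fin.last r).castSucc = a) :
    LRMultiF r a where
  chain k := M.chain k.castSucc
  antitone k := M.antitone _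
  zero := M.zero
  last i := by rw [h]
  mono k := M.mono k.castSucc
  T k := M.T k.castSucc
  lr k := M.lr k.castSucc

/-- Appends a tableau. -/
def snoc {a : ℕ → ℕ} (M : LRMultiF r a) (hα : Antitone α) (hle : ∀ i, a i ≤ α i)
    (T : ℕ → ℕ → ℕ) (hT : IsLR α a T) : LRMultiF (r + 1) α where
  chain := Fin.snoc (α := fun _ => ℕ → ℕ) M.chain α
  antitone k := by
    refine Fin.lastCases ?_ (fun k => ?_) k
    · simpa using fun i j h => hα h
    · simpa using M.antitone k
  zero i := by
    rw [← Fin.castSucc_zero, Fin.snoc_castSucc, M.zero]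
  last i := by rw [Fin.snoc_last]
  mono k := by
    refine Fin.lastCases ?_ (fun k => ?_) k
    · intro i
      rw [Fin.snoc_castSucc, Fin.succ_last, Fin.snoc_last, M.last]
      exact hle i
    · intro i
      rw [Fin.succ_castSucc, Fin.snoc_castSucc, Fin.snoc_castSucc]
      exact M.mono k i
  T := Fin.snoc (α := fun _ => ℕ → ℕ → ℕ) M.T T
  lr k := by
    refine Fin.lastCases ?_ (fun k => ?_) k
    · rw [Fin.snoc_castSucc, Fin.succ_last, Fin.snoc_last, Fin.snoc_last,
        show M.chain (Fin.last r) = a from funext M.last]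
      exact hT
    · rw [Fin.succ_castSucc, Fin.snoc_castSucc, Fin.snoc_castSucc, Fin.snoc_castSucc]
      exact M.lr k

/-- Multitableaux with a given last step. -/
def snocEquiv (Λ : ℕ → ℕ → ℕ) {a : ℕ → ℕ} (hα : Antitone α) (hle : ∀ i, a i ≤ α i) :
    {x : {M : LRMultiF (r + 1) α // ∀ k, M.cont k = Λ k} // x.1.chain (Fin.last r).castSucc = a} ≃
      {M : LRMultiF r a // ∀ k, M.cont k = Λ k} ×
        {T // IsLR α a T ∧ skewContent α a T = Λ r} where
  toFun x := ⟨⟨init x.1.1 x.2, fun k => x.1.2 k.castSucc⟩, x.1.1.T (Fin.last r), by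
    have h1 := x.1.1.lr (Fin.last r)
    have h2 := x.1.2 (Fin.last r)
    have h3 : x.1.1.chain (Fin.last r).succ = α := funext x.1.1.last
    rw [LRMultiF.cont] at h2
    rw [h3, x.2] at h1 h2
    exact ⟨h1, h2⟩⟩
  invFun y := ⟨⟨snoc y.1.1 hα hle y.2.1 y.2.2.1, fun k => by
      rw [LRMultiF.cont, snoc]
      refine Fin.lastCases ?_ (fun k => ?_) k
      · simp only []
        rw [Fin.snoc_castSucc, Fin.succ_last, Fin.snoc_last, Fin.snoc_last,
          show y.1.1.chain (Fin.last r) = a from funext y.1.1.last]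
        exact y.2.2.2
      · simp only []
        rw [Fin.succ_castSucc, Fin.snoc_castSucc, Fin.snoc_castSucc, Fin.snoc_castSucc]
        exact y.1.2 k⟩, by
    change Fin.snoc (α := fun _ => ℕ → ℕ) y.1.1.chain α (Fin.last r).castSucc = a
    rw [Fin.snoc_castSucc]
    exact funext y.1.1.last⟩
  left_inv x := by
    refine Subtype.ext (Subtype.ext (ext (funext fun k => ?_) (funext fun k => ?_)))
    · refine Fin.lastCases ?_ (fun k => ?_) k
      · simpa [snoc] using (funext x.1.1.last).symm
      · simp [snoc, init]
    · refine Fin.lastCases ?_ (fun k => ?_) k <;> simp [snoc, init]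
  right_inv y := by
    refine Prod.ext (Subtype.ext (ext (funext fun k => ?_) (funext fun k => ?_)))
      (Subtype.ext ?_) <;> simp [snoc, init]

/-- Littlewood–Richardson multitableaux of given contents are counted by `lrChain`. -/
lemma card_eq (Λ : ℕ → ℕ → ℕ) (hα : α ∈ shapes n (∑ k ∈ range r, size n (Λ k))) :
    Finite {M : LRMultiF r α // ∀ k, M.cont k = Λ k} ∧
      Nat.card {M : LRMultiF r α // ∀ k, M.cont k = Λ k} = lrChain n Λ r α := by
  induction r generalizing α with
  | zero =>
    rw [sum_range_zero, shapes_zero, mem_singleton] at hα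
    subst hα
    have : Unique {M : LRMultiF 0 0 // ∀ k, M.cont k = Λ k} :=
      { default := ⟨⟨fun _ => 0, fun _ _ _ _ => le_rfl, fun _ => rfl, fun _ => rfl,
          fun k => k.elim0, fun k => k.elim0, fun k => k.elim0⟩, fun k => k.elim0⟩
        uniq := fun M => Subtype.ext (ext (funext fun k => funext fun i => by
          rw [Fin.eq_zero k, M.1.zero]; rfl) (funext fun k => k.elim0)) }
    exact ⟨inferInstance, by rw [Nat.card_unique]; simp [lrChain, chainCount]⟩
  | succ r ih =>
    rw [mem_shapes] at hα
    have hf : ∀ x : {M : LRMultiF (r + 1) α // ∀ k, M.cont k = Λ k},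
        x.1.chain (Fin.last r).castSucc ∈ shapes n (∑ k ∈ range r, size n (Λ k)) := by
      intro x
      refine mem_shapes.2 ⟨isShape hα.1 _ _, ?_⟩
      have h1 := skewSize_add (isShape hα.1 x.1 (Fin.last r).succ) (x.1.mono (Fin.last r))
      have h2 := (isShape_cont hα.1 x.1 (Fin.last r)).2
      have h3 : x.1.chain (Fin.last r).succ = α := funext x.1.last
      rw [x.2, LRMultiF.size, Fin.val_last] at h2
      rw [← h2, h3, hα.2, sum_range_succ] at h1
      omega
    have hfib : ∀ a ∈ shapes n (∑ k ∈ range r, size n (Λ k)),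
        Finite {x : {M : LRMultiF (r + 1) α // ∀ k, M.cont k = Λ k} //
            x.1.chain (Fin.last r).castSucc = a} ∧
          Nat.card {x : {M : LRMultiF (r + 1) α // ∀ k, M.cont k = Λ k} //
            x.1.chain (Fin.last r).castSucc = a} = lrChain n Λ r a * lrPat n (Λ r) a α := by
      intro a ha
      by_cases hle : ∀ i, a i ≤ α i
      · have h1 := ih ha
        have := h1.1
        have := finite_isLR (μ := a) hα.1 fun T => skewContent α a T = Λ r
        refine ⟨Finite.of_equiv _ (snocEquiv Λ hα.1.anti hle).symm, ?_⟩
        rw [Nat.card_congr (snocEquiv Λ hα.1.anti hle), Nat.card_prod, h1.2,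
          card_isLR hα.1 (mem_shapes.1 ha).1 hle]
      · have : IsEmpty {x : {M : LRMultiF (r + 1) α // ∀ k, M.cont k = Λ k} //
            x.1.chain (Fin.last r).castSucc = a} :=
          ⟨fun x => hle fun i => x.2 ▸ chain_le x.1.1 _ i⟩
        exact ⟨inferInstance, by rw [Nat.card_of_isEmpty, lrPat_eq_zero hle, mul_zero]⟩
    have : ∀ a, Finite {x : {M : LRMultiF (r + 1) α // ∀ k, M.cont k = Λ k} //
        x.1.chain (Fin.last r).castSucc = a} := by
      intro a
      by_cases ha : a ∈ shapes n (∑ k ∈ range r, size n (Λ k))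
      · exact (hfib a ha).1
      · have : IsEmpty {x : {M : LRMultiF (r + 1) α // ∀ k, M.cont k = Λ k} //
            x.1.chain (Fin.last r).castSucc = a} := ⟨fun x => ha (x.2 ▸ hf x.1)⟩
        infer_instance
    obtain ⟨h1, h2⟩ := sum_card_fiber
      (fun x : {M : LRMultiF (r + 1) α // ∀ k, M.cont k = Λ k} =>
        x.1.chain (Fin.last r).castSucc) hf
    refine ⟨h1, h2.trans ?_⟩
    exact sum_congr rfl fun a ha => (hfib a ha).2

end LRMulti

/-! ### The number of pairs of multitableaux -/

/-- Extension of a family indexed by `Fin n`. -/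
def extFam {n : ℕ} (Λ : Fin n → ℕ → ℕ) : ℕ → ℕ → ℕ := fun k => if h : k < n then Λ ⟨k, h⟩ else 0

lemma extFam_coe {n : ℕ} (Λ : Fin n → ℕ → ℕ) (k : Fin n) : extFam Λ k = Λ k := by
  simp [extFam]

section
variable {n : ℕ} {α β c : ℕ → ℕ}

/-- Pairs of multitableaux with prescribed contents of the first. -/
def pairsEquiv (hα : α ∈ shapes n n) (hβ : β ∈ shapes n n) (hc : ∀ k, c k ≤ n)
    {Λ : Fin n → ℕ → ℕ} (hΛ : Λ ∈ Fintype.piFinset fun k : Fin n => shapes n (c k)) :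
    {x : LRPairsStar n n α β (fun k => c k) // (fun k => x.1.1.cont k) = Λ} ≃
      {M : LRMultiF n α // ∀ k, M.cont k = extFam Λ k} ×
        {M : LRMultiF n β // ∀ k, M.cont k = conjFun n (extFam Λ k)} where
  toFun x := ⟨⟨x.1.1.1, fun k => (congrFun x.2 k).trans (extFam_coe Λ k).symm⟩,
    ⟨x.1.1.2, fun k => (funext (x.1.2.2.2 k)).trans
      (congrArg (conjFun n) ((congrFun x.2 k).trans (extFam_coe Λ k).symm))⟩⟩
  invFun y := ⟨⟨(y.1.1, y.2.1), fun k => by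
      rw [← (LRMulti.isShape_cont (mem_shapes.1 hα).1 y.1.1 k).2, y.1.2 k, extFam_coe]
      exact (mem_shapes.1 (Fintype.mem_piFinset.1 hΛ k)).2, fun k => by
      rw [← (LRMulti.isShape_cont (mem_shapes.1 hβ).1 y.2.1 k).2, y.2.2 k, extFam_coe]
      exact (mem_shapes.1 (conjFun_mem_shapes (hc k) (Fintype.mem_piFinset.1 hΛ k))).2,
    fun k m => by rw [y.2.2 k, y.1.2 k]⟩, funext fun k => (y.1.2 k).trans (extFam_coe Λ k)⟩
  left_inv _ := rfl
  right_inv _ := rfl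

lemma sum_size_extFam (hn : size n c = n) (Λ : Fin n → ℕ → ℕ) (hΛ : ∀ k, size n (Λ k) = c k) :
    ∑ k ∈ range n, size n (extFam Λ k) = n := by
  rw [sum_range]
  simp only [extFam_coe, hΛ]
  rw [← sum_range, ← size, hn]

lemma lrStarNum_eq (hα : α ∈ shapes n n) (hβ : β ∈ shapes n n) (hn : size n c = n)
    (hc : ∀ k, c k ≤ n) :
    (lrStarNum n n α β (fun k => c k) : ℚ) =
      ∑ Λ ∈ Fintype.piFinset fun k : Fin n => shapes n (c k),
        schurCoeff n α (∏ k, schur n (Λ k)) *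
          schurCoeff n β (∏ k, schur n (conjFun n (Λ k))) := by
  have hf : ∀ x : LRPairsStar n n α β (fun k => c k),
      (fun k => x.1.1.cont k) ∈ Fintype.piFinset fun k : Fin n => shapes n (c k) := fun x =>
    Fintype.mem_piFinset.2 fun k => by
      have := LRMulti.isShape_cont (mem_shapes.1 hα).1 x.1.1 k
      exact mem_shapes.2 ⟨this.1, this.2.trans (x.2.1 k)⟩
  have hcard : ∀ Λ ∈ Fintype.piFinset fun k : Fin n => shapes n (c k),
      Finite {x : LRPairsStar n n α β (fun k => c k) // (fun k => x.1.1.cont k) = Λ} ∧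
        (Nat.card {x : LRPairsStar n n α β (fun k => c k) // (fun k => x.1.1.cont k) = Λ} : ℚ) =
          schurCoeff n α (∏ k, schur n (Λ k)) *
            schurCoeff n β (∏ k, schur n (conjFun n (Λ k))) := by
    intro Λ hΛ
    have hΛ' := Fintype.mem_piFinset.1 hΛ
    have h1 : ∑ k ∈ range n, size n (extFam Λ k) = n :=
      sum_size_extFam hn Λ fun k => (mem_shapes.1 (hΛ' k)).2
    have h2 : ∑ k ∈ range n, size n (conjFun n (extFam Λ k)) = n := by
      refine Eq.trans ?_ (sum_size_extFam hn (fun k => conjFun n (Λ k))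
        fun k => (mem_shapes.1 (conjFun_mem_shapes (hc k) (hΛ' k))).2)
      rw [sum_range, sum_range]
      simp only [extFam_coe]
    have h3 := LRMulti.card_eq (r := n) (α := α) (extFam Λ) (by rwa [h1])
    have h4 := LRMulti.card_eq (r := n) (α := β) (fun k => conjFun n (extFam Λ k)) (by rwa [h2])
    have := h3.1
    have := h4.1
    refine ⟨Finite.of_equiv _ (pairsEquiv hα hβ hc hΛ).symm, ?_⟩
    rw [Nat.card_congr (pairsEquiv hα hβ hc hΛ), Nat.card_prod, h3.2, h4.2, Nat.cast_mul,
      ← schurCoeff_prod (by rwa [h1]), ← schurCoeff_prod (by rwa [h2]), prod_range, prod_range]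
    simp only [extFam_coe]
  have : ∀ Λ, Finite {x : LRPairsStar n n α β (fun k => c k) // (fun k => x.1.1.cont k) = Λ} := by
    intro Λ
    by_cases hΛ : Λ ∈ Fintype.piFinset fun k : Fin n => shapes n (c k)
    · exact (hcard Λ hΛ).1
    · have : IsEmpty {x : LRPairsStar n n α β (fun k => c k) // (fun k => x.1.1.cont k) = Λ} :=
        ⟨fun x => hΛ (x.2 ▸ hf x.1)⟩
      infer_instance
  rw [lrStarNum, (sum_card_fiber (fun x : LRPairsStar n n α β (fun k => c k) =>
    fun k => x.1.1.cont k) hf).2, Nat.cast_sum]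
  exact sum_congr rfl fun Λ hΛ => (hcard Λ hΛ).2

end

/-! ### Partitions as shapes -/

lemma sum_getD {n : ℕ} {L : List ℕ} (h : L.length ≤ n) :
    ∑ i ∈ range n, L.getD i 0 = L.sum := by
  induction L generalizing n with
  | nil => simp
  | cons x L ih =>
    obtain ⟨m, rfl⟩ : ∃ m, n = m + 1 := ⟨n - 1, by simp at h; omega⟩
    rw [sum_range_succ', List.sum_cons, add_comm]
    simp only [List.getD_cons_succ, List.getD_cons_zero]
    rw [ih (by simpa using h)]

lemma pf_mem_shapes {n : ℕ} (P : n.Partition) : pf P ∈ shapes n n := by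
  have hlen : (P.parts.sort (· ≤ ·)).reverse.length ≤ n := by
    rw [List.length_reverse, Multiset.length_sort]
    have := Multiset.card_nsmul_le_sum (s := P.parts) (a := 1) fun x hx => P.parts_pos hx
    rwa [P.parts_sum, smul_eq_mul, mul_one] at this
  have hsorted : (P.parts.sort (· ≤ ·)).reverse.Pairwise (· ≥ ·) :=
    List.pairwise_reverse.2 (P.parts.pairwise_sort (· ≤ ·))
  refine mem_shapes.2 ⟨⟨fun i j hij => ?_, fun i hi => ?_⟩, ?_⟩
  · rcases hij.eq_or_lt with rfl | hij
    · exact le_rfl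
    by_cases hj : j < (P.parts.sort (· ≤ ·)).reverse.length
    · rw [pf, pf, List.getD_eq_getElem _ _ hj, List.getD_eq_getElem _ _ (hij.trans hj)]
      exact List.pairwise_iff_getElem.1 hsorted i j _ _ hij
    · rw [pf, List.getD_eq_default _ _ (not_lt.1 hj)]
      exact Nat.zero_le _
  · exact List.getD_eq_default _ _ (hlen.trans hi)
  · refine (sum_getD hlen).trans ?_
    rw [List.sum_reverse, ← Multiset.sum_coe, Multiset.sort_eq, P.parts_sum]

lemma pf_injective {n : ℕ} : Function.Injective (pf (n := n)) := by
  intro P Q h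
  have hlen : ∀ (R : n.Partition) i, 0 < pf R i ↔ i < (R.parts.sort (· ≤ ·)).reverse.length := by
    intro R i
    by_cases hi : i < (R.parts.sort (· ≤ ·)).reverse.length
    · rw [pf, List.getD_eq_getElem _ _ hi]
      refine iff_of_true (R.parts_pos ?_) hi
      rw [← Multiset.mem_sort (r := (· ≤ ·)), ← List.mem_reverse]
      exact List.getElem_mem hi
    · rw [pf, List.getD_eq_default _ _ (not_lt.1 hi)]
      exact iff_of_false (lt_irrefl 0) hi
  have h1 : (P.parts.sort (· ≤ ·)).reverse = (Q.parts.sort (· ≤ ·)).reverse := by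
    refine List.ext_getElem (eq_of_forall_lt_iff fun i => by rw [← hlen, ← hlen, h])
      fun i hi hi' => ?_
    rw [← List.getD_eq_getElem _ 0 hi, ← List.getD_eq_getElem _ 0 hi']
    exact congrFun h i
  refine Nat.Partition.ext ?_
  rw [← Multiset.sort_eq P.parts (· ≤ ·), ← Multiset.sort_eq Q.parts (· ≤ ·),
    List.reverse_injective h1]

lemma exists_pf_eq {n : ℕ} {a : ℕ → ℕ} (ha : a ∈ shapes n n) : ∃ P : n.Partition, pf P = a := by
  rw [mem_shapes] at ha
  have hk := fun i => lt_conjFun ha.1 i 0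
  set k := conjFun n a 0
  have hkn : k ≤ n := conjFun_le n a 0
  have hsize : size k a = n := by
    rw [← size_eq_of_le hkn fun i hi => by have := hk i; omega, ha.2]
  have hsort : (((List.range k).map a : List ℕ) : Multiset ℕ).sort (· ≤ ·) =
      ((List.range k).map a).reverse := by
    refine List.Perm.eq_of_pairwise' (r := (· ≤ ·)) (Multiset.pairwise_sort _ _) ?_ ?_
    · rw [List.pairwise_reverse, List.pairwise_map]
      exact List.pairwise_lt_range.imp fun h => ha.1.anti h.le
    · rw [← Multiset.coe_eq_coe, Multiset.sort_eq, Multiset.coe_reverse]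
  refine ⟨⟨((List.range k).map a : List ℕ), fun {i} hi => ?_, ?_⟩, ?_⟩
  · simp only [Multiset.mem_coe, List.mem_map, List.mem_range] at hi
    obtain ⟨j, hj, rfl⟩ := hi
    exact (hk j).1 hj
  · exact hsize
  · funext i
    rw [pf, hsort, List.reverse_reverse]
    by_cases hi : i < k
    · rw [List.getD_eq_getElem _ _ (by simpa using hi)]
      simp
    · rw [List.getD_eq_default _ _ (by simpa using hi)]
      have := hk i
      omega

lemma sum_shapes {n : ℕ} (f : (ℕ → ℕ) → ℚ) :
    ∑ l ∈ shapes n n, f l = ∑ γ : n.Partition, f (pf γ) := by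
  refine (sum_nbij pf (fun γ _ => pf_mem_shapes γ) (pf_injective.injOn) (fun a ha => ?_)
    fun _ _ => rfl).symm
  obtain ⟨P, rfl⟩ := exists_pf_eq (mem_coe.1 ha)
  exact ⟨P, mem_coe.2 (mem_univ P), rfl⟩

/-- The conjugate Kostka numbers vanish unless the shape is dominated. -/
lemma dominates_of_cf_ne_zero {n : ℕ} {a l : ℕ → ℕ} (ha : a ∈ shapes n n) (hl : l ∈ shapes n n)
    (h : cf (fun i => conjFun n a i) (schur n (conjFun n l)) ≠ 0) : Dominates a l := by
  have hn := (mem_shapes.1 (conjFun_mem_shapes le_rfl ha)).2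
  rw [← vChain_eq_cf hn.le (by rwa [hn]), Nat.cast_ne_zero] at h
  intro k
  refine (size_le_of_vChain_ne_zero l (by rwa [hn]) h k).trans_eq ?_
  change _ = size k a
  rw [← sum_conjFun (n := k) (N := n) fun i =>
    (le_size (mem_shapes.1 ha).1 i).trans_eq (mem_shapes.1 ha).2]
  refine sum_congr rfl fun j _ => ?_
  rw [conjFun.eq_1 k, ← card_range (min k (conjFun n a j))]
  congr 1
  ext i
  simp only [mem_range, mem_filter, lt_min_iff, lt_conjFun (mem_shapes.1 ha).1]

end
end KroneckerLR

/-- `lr*(α,β;ν') = ∑_{γ ⊴ ν} K_{γ'ν'} k(α,β,γ)`. -/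
theorem stmt11 (n : ℕ) (α β ν : n.Partition) :
    (lrStarNum n n (pf α) (pf β) (fun k : Fin n => conjFun n (pf ν) k) : ℚ) =
      ∑ γ : n.Partition,
        if Dominates (pf ν) (pf γ) then
          (kostka (conjFun n (pf γ)) (conjFun n (pf ν)) : ℚ) * kron n (pf α) (pf β) (pf γ)
        else 0 := by
  open KroneckerLR in
  have hc := mem_shapes.1 (conjFun_mem_shapes le_rfl (pf_mem_shapes ν))
  rw [lrStarNum_eq (pf_mem_shapes α) (pf_mem_shapes β) hc.2 (conjFun_le n _),
    ← sum_mul_kron hc.1.zero hc.2, sum_shapes]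
  refine sum_congr rfl fun γ _ => ?_
  have hγ := conjFun_mem_shapes le_rfl (pf_mem_shapes γ)
  split_ifs with h
  · rw [kostka_eq (mem_shapes.1 hγ).1 hc.1.zero, ← cf_schur]
  · rw [by_contra fun h0 => h (dominates_of_cf_ne_zero (pf_mem_shapes ν) (pf_mem_shapes γ) h0),
      zero_mul]
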